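/- (Estimation-error part of Proposition 1.) Suppose the boundedness, α-margin, and compatibility-on-the-optimal-arm assumptions hold. Let δ ∈ (0,1] and τ₁ ∈ ℕ₀ be given, and let τ₂ satisfy τ₂ ≥ max{C₂ log(7d/δ) + 2C₂ log log(28dC₂²/δ), τ₁ + (2048x_max⁴s₀²/φ*⁴)(log(d²/δ) + 2 log(64x_max²s₀/φ*²)), 2τ₁, w²M₀}, where C₂ = max{2, (400σx_max²s₀/(Δ*φ*²))²·(80x_max²s₀/φ*²)^{2/α}}. Suppose the learner runs FS-WLasso with regularization λ_t = 4σx_max(√(2w²M₀ log(2d/δ)) + 2^{3/4}·√((t−M₀)·log(7d(log 2(t−M₀))²/δ))) for t > M₀, and suppose that almost surely φ²(V̂_{M₀+τ₁}, S₀) ≥ max{(4x_max s₀/Δ*)·(80x_max²s₀/φ*²)^{1/α}·λ_{M₀+τ₂}, 64x_max²s₀·log(1/δ)}. Then with probability at least 1 − 4δ, for every t ≥ M₀ + τ₂ + 1, ‖β* − β̂_t‖₁ ≤ (200σx_max s₀/φ*²)·√((2 log log 2(t−M₀) + log(7d/δ))/(t−M₀)). -/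

import Mathlib

set_option autoImplicit false

open MeasureTheory ProbabilityTheory Matrix Finset
open scoped Classical ENNReal

noncomputable section

namespace Paper

section Compat

variable {ι : Type*} [Fintype ι] [DecidableEq ι]

def l1 (v : ι → ℝ) : ℝ := ∑ j, |v j|

def restr (S : Finset ι) (v : ι → ℝ) : ι → ℝ := fun j => if j ∈ S then v j else 0

def compat (M : Matrix ι ι ℝ) (S : Finset ι) : ℝ :=
  sInf {c : ℝ | ∃ v : ι → ℝ, l1 (restr Sᶜ v) ≤ 3 * l1 (restr S v) ∧ restr S v ≠ 0 ∧
    c = (S.card : ℝ) * (v ⬝ᵥ (M *ᵥ v)) / l1 (restr S v) ^ 2}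

def gram {Ω : Type*} [MeasurableSpace Ω] (P : Measure Ω) (x : Ω → ι → ℝ) : Matrix ι ι ℝ :=
  Matrix.of fun i j => ∫ ω, x ω i * x ω j ∂P

end Compat

def supp {d : ℕ} (β : Fin d → ℝ) : Finset (Fin d) := Finset.univ.filter fun j => β j ≠ 0

def gapOf {K d : ℕ} (βstar : Fin d → ℝ) (x : Fin K → Fin d → ℝ) (astar : Fin K) : ℝ :=
  x astar ⬝ᵥ βstar - ⨆ k : {k : Fin K // k ≠ astar}, x k.1 ⬝ᵥ βstar

variable {Ω : Type*}

def reward {d K : ℕ} (X : ℕ → Ω → Fin K → Fin d → ℝ) (act : ℕ → Ω → Fin K)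
    (βstar : Fin d → ℝ) (η : ℕ → Ω → ℝ) (t : ℕ) (ω : Ω) : ℝ :=
  X t ω (act t ω) ⬝ᵥ βstar + η t ω

def sigF [MeasurableSpace Ω] {d K : ℕ} (X : ℕ → Ω → Fin K → Fin d → ℝ)
    (act : ℕ → Ω → Fin K) (r : ℕ → Ω → ℝ) (t : ℕ) : MeasurableSpace Ω :=
  (⨆ i ∈ Finset.Icc 1 t, MeasurableSpace.comap (X i) inferInstance) ⊔
    (⨆ i ∈ Finset.Icc 1 t, MeasurableSpace.comap (act i) inferInstance) ⊔
    (⨆ i ∈ Finset.Icc 1 (t - 1), MeasurableSpace.comap (r i) inferInstance)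

def sigFplus [MeasurableSpace Ω] {d K : ℕ} (X : ℕ → Ω → Fin K → Fin d → ℝ)
    (act : ℕ → Ω → Fin K) (r : ℕ → Ω → ℝ) (t : ℕ) : MeasurableSpace Ω :=
  (⨆ i ∈ Finset.Icc 1 t, MeasurableSpace.comap (X i) inferInstance) ⊔
    (⨆ i ∈ Finset.Icc 1 t, MeasurableSpace.comap (act i) inferInstance) ⊔
    (⨆ i ∈ Finset.Icc 1 t, MeasurableSpace.comap (r i) inferInstance)

def regret {d K : ℕ} (X : ℕ → Ω → Fin K → Fin d → ℝ) (act astar : ℕ → Ω → Fin K)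
    (βstar : Fin d → ℝ) (t : ℕ) (ω : Ω) : ℝ :=
  X t ω (astar t ω) ⬝ᵥ βstar - X t ω (act t ω) ⬝ᵥ βstar

def avgGram [MeasurableSpace Ω] (P : Measure Ω) {d K : ℕ}
    (X : ℕ → Ω → Fin K → Fin d → ℝ) : Matrix (Fin d) (Fin d) ℝ :=
  Matrix.of fun i j => (K : ℝ)⁻¹ * ∫ ω, ∑ k, X 1 ω k i * X 1 ω k j ∂P

/-- The sparse linear contextual bandit model, under the boundedness, `α`-margin, and
compatibility-condition-on-the-optimal-arm assumptions. -/
structure Model (Ω : Type*) [MeasurableSpace Ω] (P : Measure Ω) (d K : ℕ) where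
  /-- the i.i.d. context tuples, round by round -/
  X : ℕ → Ω → Fin K → Fin d → ℝ
  /-- the noise sequence -/
  η : ℕ → Ω → ℝ
  /-- the actions chosen by the learner -/
  act : ℕ → Ω → Fin K
  /-- the optimal arms -/
  astar : ℕ → Ω → Fin K
  /-- the unknown parameter -/
  βstar : Fin d → ℝ
  /-- the sub-Gaussian parameter of the noise -/
  σ : ℝ
  /-- the bound on the sup norm of the contexts -/
  xmax : ℝ
  /-- the bound on the ℓ¹ norm of the parameter -/
  b : ℝ
  /-- the margin exponent -/
  α : ℝ
  /-- the margin constant -/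
  Δstar : ℝ
  /-- the compatibility constant of the optimal arm -/
  φstar : ℝ
  /-- the common law of the context tuples -/
  DX : Measure (Fin K → Fin d → ℝ)
  hK : 2 ≤ K
  probMeas : IsProbabilityMeasure P
  hσ : 0 < σ
  hxmax : 0 < xmax
  hb : 0 < b
  hα : 0 < α
  hΔstar : 0 < Δstar
  hφstar : 0 < φstar
  measX : ∀ t, Measurable (X t)
  measη : ∀ t, Measurable (η t)
  measAct : ∀ t, Measurable (act t)
  measAstar : ∀ t, Measurable (astar t)
  /-- the context tuples are identically distributed across rounds -/
  ident : ∀ t, 1 ≤ t → P.map (X t) = DX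
  /-- the round-`t` context tuple is independent of the past -/
  indepX : ∀ t, 1 ≤ t → Indep (MeasurableSpace.comap (X t) inferInstance)
      (sigFplus X act (reward X act βstar η) (t - 1)) P
  /-- the noise has a conditional moment generating function -/
  noiseInt : ∀ t, 1 ≤ t → ∀ s : ℝ, Integrable (fun ω => Real.exp (s * η t ω)) P
  /-- the noise is conditionally `σ`-sub-Gaussian -/
  subG : ∀ t, 1 ≤ t → ∀ s : ℝ, ∀ᵐ ω ∂P,
      (P[fun ω' => Real.exp (s * η t ω') | sigF X act (reward X act βstar η) t]) ω ≤
        Real.exp (s ^ 2 * σ ^ 2 / 2)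
  /-- boundedness of the contexts -/
  bddX : ∀ t, 1 ≤ t → ∀ᵐ ω ∂P, ∀ k j, |X t ω k j| ≤ xmax
  /-- boundedness of the parameter -/
  bddβ : l1 βstar ≤ b
  /-- nontrivial support -/
  suppNe : (supp βstar).Nonempty
  /-- `astar t` is the optimal arm in round `t` -/
  optAstar : ∀ t ω k, X t ω k ⬝ᵥ βstar ≤ X t ω (astar t ω) ⬝ᵥ βstar
  /-- the `α`-margin condition -/
  margin : ∀ t, 1 ≤ t → ∀ h : ℝ, 0 < h →
      P {ω | gapOf βstar (X t ω) (astar t ω) ≤ h} ≤ ENNReal.ofReal ((h / Δstar) ^ α)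
  /-- the compatibility condition on the optimal arm -/
  compatOpt : ∀ t, 1 ≤ t →
      compat (gram P fun ω => X t ω (astar t ω)) (supp βstar) ≥ φstar ^ 2

/-- The `FS-WLasso` algorithm run on the sparse linear contextual bandit model. -/
structure FSWLasso (Ω : Type*) [MeasurableSpace Ω] (P : Measure Ω) (d K : ℕ)
    extends Model Ω P d K where
  /-- the length of the forced-sampling stage -/
  M0 : ℕ
  /-- the weight between the two parts of the loss -/
  w : ℝ
  /-- the regularization parameters -/
  lam : ℕ → ℝ
  /-- `βhat t` is the weighted-loss Lasso estimator computed from the data of rounds `1..t` -/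
  βhat : ℕ → Ω → Fin d → ℝ
  hw : 0 ≤ w
  measβhat : ∀ t, Measurable[sigFplus X act (reward X act βstar η) t] (βhat t)
  /-- in the forced-sampling stage the arm is drawn uniformly at random -/
  unif : ∀ t, 1 ≤ t → t ≤ M0 → ∀ k, P {ω | act t ω = k} = (K : ℝ≥0∞)⁻¹
  /-- the forced-sampling randomization is independent of the current contexts and the past -/
  unifIndep : ∀ t, 1 ≤ t → t ≤ M0 →
      Indep (MeasurableSpace.comap (act t) inferInstance)
        (sigFplus X act (reward X act βstar η) (t - 1) ⊔
          MeasurableSpace.comap (X t) inferInstance) P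
  /-- `βhat t` minimizes the weighted squared-error Lasso objective over the data of
  rounds `1..t` -/
  lasso : ∀ t, M0 ≤ t → ∀ ω, ∀ β : Fin d → ℝ,
      w * ∑ i ∈ Finset.Icc 1 M0,
          (X i ω (act i ω) ⬝ᵥ βhat t ω - reward X act βstar η i ω) ^ 2 +
        ∑ i ∈ Finset.Icc (M0 + 1) t,
          (X i ω (act i ω) ⬝ᵥ βhat t ω - reward X act βstar η i ω) ^ 2 +
        lam t * l1 (βhat t ω) ≤
      w * ∑ i ∈ Finset.Icc 1 M0, (X i ω (act i ω) ⬝ᵥ β - reward X act βstar η i ω) ^ 2 +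
        ∑ i ∈ Finset.Icc (M0 + 1) t, (X i ω (act i ω) ⬝ᵥ β - reward X act βstar η i ω) ^ 2 +
        lam t * l1 β
  /-- in the greedy stage the learner chooses the arm maximizing the estimated reward -/
  greedy : ∀ t, M0 < t → ∀ ω k,
      X t ω k ⬝ᵥ βhat (t - 1) ω ≤ X t ω (act t ω) ⬝ᵥ βhat (t - 1) ω

/-- The (weighted) empirical Gram matrix `V̂_{M₀+n}`. -/
def Vhat [MeasurableSpace Ω] {P : Measure Ω} {d K : ℕ} (A : FSWLasso Ω P d K) (n : ℕ)
    (ω : Ω) : Matrix (Fin d) (Fin d) ℝ :=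
  Matrix.of fun i j =>
    A.w * ∑ t ∈ Finset.Icc 1 A.M0, A.X t ω (A.act t ω) i * A.X t ω (A.act t ω) j +
      ∑ t ∈ Finset.Icc (A.M0 + 1) (A.M0 + n), A.X t ω (A.act t ω) i * A.X t ω (A.act t ω) j


def stopW (Y : ℕ → Ω → ℝ≥0∞) (c : ℝ≥0∞) : ℕ → Ω → ℝ≥0∞
  | 0 => fun _ => 1
  | n + 1 => fun ω => if c ≤ stopW Y c n ω then stopW Y c n ω else stopW Y c n ω * Y n ω

lemma stopW_spec (Y : ℕ → Ω → ℝ≥0∞) (c : ℝ≥0∞) (ω : Ω) (n : ℕ) :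
    c ≤ stopW Y c n ω ∨ (stopW Y c n ω = ∏ i ∈ Finset.range n, Y i ω ∧
      ∀ k ≤ n, ¬ c ≤ ∏ i ∈ Finset.range k, Y i ω) := by
  induction n with
  | zero =>
    by_cases h : c ≤ 1
    · left; simpa [stopW] using h
    · right
      refine ⟨by simp [stopW], ?_⟩
      intro k hk
      obtain rfl : k = 0 := by omega
      simpa using h
  | succ n ih =>
    rcases ih with h | ⟨h1, h2⟩
    · left
      simp only [stopW, if_pos h]; exact h
    · have hn : ¬ c ≤ stopW Y c n ω := by rw [h1]; exact h2 n le_rfl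
      have e : stopW Y c (n+1) ω = ∏ i ∈ Finset.range (n+1), Y i ω := by
        simp only [stopW, if_neg hn]
        rw [Finset.prod_range_succ, h1]
      by_cases hc : c ≤ stopW Y c (n+1) ω
      · left; exact hc
      · right
        refine ⟨e, ?_⟩
        intro k hk
        rcases Nat.lt_or_ge k (n+1) with hk' | hk'
        · exact h2 k (by omega)
        · obtain rfl : k = n + 1 := by omega
          rw [← e]; exact hc

lemma ville [mΩ : MeasurableSpace Ω] (P : Measure Ω) [IsProbabilityMeasure P]
    (m : ℕ → MeasurableSpace Ω) (hm : ∀ i, m i ≤ mΩ) (hmono : Monotone m)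
    (Y : ℕ → Ω → ℝ≥0∞) (hY : ∀ i, Measurable[m (i+1)] (Y i))
    (h : ∀ i, ∀ Z : Ω → ℝ≥0∞, Measurable[m i] Z → ∫⁻ ω, Z ω * Y i ω ∂P ≤ ∫⁻ ω, Z ω ∂P)
    (c : ℝ≥0∞) (hc0 : c ≠ 0) (hct : c ≠ ⊤) :
    P {ω | ∃ n, c ≤ ∏ i ∈ Finset.range n, Y i ω} ≤ c⁻¹ := by
  have hW : ∀ n, Measurable[m n] (stopW Y c n) := by
    intro n
    induction n with
    | zero => exact @measurable_const _ _ _ (m 0) _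
    | succ n ih =>
      have ih' : Measurable[m (n+1)] (stopW Y c n) := ih.mono (hmono (Nat.le_succ n)) le_rfl
      have hs : MeasurableSet[m (n+1)] {ω | c ≤ stopW Y c n ω} :=
        ih' (measurableSet_Ici (a := c))
      exact Measurable.ite hs ih' (ih'.mul (hY n))
  have hW' : ∀ n, Measurable (stopW Y c n) := fun n => (hW n).mono (hm n) le_rfl
  have hI : ∀ n, ∫⁻ ω, stopW Y c n ω ∂P ≤ 1 := by
    intro n
    induction n with
    | zero => simp [stopW]
    | succ n ih =>
      refine le_trans ?_ ih
      have hs : MeasurableSet[m n] {ω | c ≤ stopW Y c n ω} :=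
        hW n (measurableSet_Ici (a := c))
      set A := {ω | c ≤ stopW Y c n ω} with hA
      have hsA : MeasurableSet A := hm n _ hs
      have hZ : Measurable[m n] (Aᶜ.indicator (stopW Y c n)) :=
        (hW n).indicator hs.compl
      have h1 := h n _ hZ
      calc ∫⁻ ω, stopW Y c (n+1) ω ∂P
          = ∫⁻ ω, (A.indicator (stopW Y c n) ω + Aᶜ.indicator (stopW Y c n) ω * Y n ω) ∂P := by
            refine lintegral_congr fun ω => ?_
            by_cases hω : c ≤ stopW Y c n ω
            · simp [stopW, hA, Set.indicator, hω]
            · simp [stopW, hA, Set.indicator, hω]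
        _ = ∫⁻ ω, A.indicator (stopW Y c n) ω ∂P + ∫⁻ ω, Aᶜ.indicator (stopW Y c n) ω * Y n ω ∂P :=
            lintegral_add_left ((hW' n).indicator hsA) _
        _ ≤ ∫⁻ ω, A.indicator (stopW Y c n) ω ∂P + ∫⁻ ω, Aᶜ.indicator (stopW Y c n) ω ∂P := by
            gcongr
        _ = ∫⁻ ω, stopW Y c n ω ∂P := by
            rw [← lintegral_add_left ((hW' n).indicator hsA)]
            refine lintegral_congr fun ω => ?_
            exact Set.indicator_self_add_compl_apply A (stopW Y c n) ω
  have hmon : Monotone fun n => {ω | c ≤ stopW Y c n ω} := by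
    refine monotone_nat_of_le_succ fun n ω hω => ?_
    simp only [Set.mem_ofPred_eq] at hω ⊢
    simp only [stopW, if_pos hω]; exact hω
  calc P {ω | ∃ n, c ≤ ∏ i ∈ Finset.range n, Y i ω}
      ≤ P (⋃ n, {ω | c ≤ stopW Y c n ω}) := by
        refine measure_mono ?_
        rintro ω ⟨n, hn⟩
        rw [Set.mem_iUnion]
        refine ⟨n, ?_⟩
        rcases stopW_spec Y c ω n with h1 | ⟨_, h2⟩
        · exact h1
        · exact absurd hn (h2 n le_rfl)
    _ = ⨆ n, P {ω | c ≤ stopW Y c n ω} := hmon.measure_iUnion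
    _ ≤ c⁻¹ := by
        refine iSup_le fun n => ?_
        refine (meas_ge_le_lintegral_div (hW' n).aemeasurable hc0 hct).trans ?_
        rw [div_eq_mul_inv]
        calc _ ≤ 1 * c⁻¹ := by gcongr; exact hI n
          _ = _ := one_mul _

lemma ville_real [mΩ : MeasurableSpace Ω] (P : Measure Ω) [IsProbabilityMeasure P]
    (m : ℕ → MeasurableSpace Ω) (hm : ∀ i, m i ≤ mΩ) (hmono : Monotone m)
    (U : ℕ → Ω → ℝ) (hU : ∀ i, Measurable[m (i+1)] (U i))
    (h : ∀ i, ∀ Z : Ω → ℝ≥0∞, Measurable[m i] Z →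
      ∫⁻ ω, Z ω * ENNReal.ofReal (Real.exp (U i ω)) ∂P ≤ ∫⁻ ω, Z ω ∂P)
    (ℓ : ℝ) :
    P {ω | ∃ n, ℓ ≤ ∑ i ∈ Finset.range n, U i ω} ≤ ENNReal.ofReal (Real.exp (-ℓ)) := by
  have := ville P m hm hmono (fun i ω => ENNReal.ofReal (Real.exp (U i ω)))
    (fun i => by
      have := hU i
      exact (ENNReal.measurable_ofReal.comp Real.measurable_exp).comp this) h
    (ENNReal.ofReal (Real.exp ℓ)) (by simp [Real.exp_pos]) ENNReal.ofReal_ne_top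
  rw [Real.exp_neg, ENNReal.ofReal_inv_of_pos (Real.exp_pos _)]
  refine le_trans (measure_mono ?_) this
  rintro ω ⟨n, hn⟩
  refine ⟨n, ?_⟩
  rw [← ENNReal.ofReal_prod_of_nonneg (fun i _ => (Real.exp_pos _).le), ← Real.exp_sum]
  exact ENNReal.ofReal_le_ofReal (Real.exp_le_exp.2 hn)

lemma condExp_step (m : MeasurableSpace Ω) [mΩ : MeasurableSpace Ω] (P : Measure Ω)
    [IsProbabilityMeasure P] (hm : m ≤ mΩ) (f : Ω → ℝ) (hf : Measurable f) (hf0 : ∀ ω, 0 ≤ f ω)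
    (hfi : Integrable f P) (C : ℝ) (hC0 : 0 ≤ C) (hC : ∀ᵐ ω ∂P, (P[f | m]) ω ≤ C)
    (Z : Ω → ℝ≥0∞) (hZ : Measurable[m] Z) :
    ∫⁻ ω, Z ω * ENNReal.ofReal (f ω) ∂P ≤ ENNReal.ofReal C * ∫⁻ ω, Z ω ∂P := by
  have hle : (P.withDensity fun ω => ENNReal.ofReal (f ω)).trim hm
      ≤ ENNReal.ofReal C • P.trim hm := by
    rw [Measure.le_iff]
    intro s hs
    rw [trim_measurableSet_eq hm hs, Measure.smul_apply, trim_measurableSet_eq hm hs,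
      withDensity_apply _ (hm s hs), ← ofReal_integral_eq_lintegral_ofReal hfi.integrableOn
        (Filter.Eventually.of_forall hf0), ← setIntegral_condExp hm hfi hs, smul_eq_mul]
    have h1 : ∫ ω in s, (P[f | m]) ω ∂P ≤ ∫ ω in s, C ∂P := by
      refine integral_mono_ae integrable_condExp.integrableOn (integrable_const _) ?_
      exact ae_restrict_of_ae hC
    refine (ENNReal.ofReal_le_ofReal h1).trans ?_
    rw [integral_const, smul_eq_mul, mul_comm, ENNReal.ofReal_mul hC0]
    gcongr
    simp [Measure.real]
  have hZ' : Measurable Z := hZ.mono hm le_rfl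
  calc ∫⁻ ω, Z ω * ENNReal.ofReal (f ω) ∂P
      = ∫⁻ ω, Z ω ∂(P.withDensity fun ω => ENNReal.ofReal (f ω)) := by
        rw [lintegral_withDensity_eq_lintegral_mul P hf.ennreal_ofReal hZ']
        refine lintegral_congr fun ω => ?_
        simp [mul_comm]
    _ = ∫⁻ ω, Z ω ∂((P.withDensity fun ω => ENNReal.ofReal (f ω)).trim hm) :=
        (lintegral_trim hm hZ).symm
    _ ≤ ∫⁻ ω, Z ω ∂(ENNReal.ofReal C • P.trim hm) := lintegral_mono' hle le_rfl
    _ = ENNReal.ofReal C * ∫⁻ ω, Z ω ∂P := by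
        rw [lintegral_smul_measure, lintegral_trim hm hZ, smul_eq_mul]

lemma exp_convex (B x y : ℝ) (hB : 0 < B) (hx : |x| ≤ B) :
    Real.exp (x * y) ≤ (B + x) / (2 * B) * Real.exp (B * y) +
      (B - x) / (2 * B) * Real.exp (-B * y) := by
  obtain ⟨h1, h2⟩ := abs_le.1 hx
  have e1 : 0 ≤ (B + x) / (2 * B) := div_nonneg (by linarith) (by linarith)
  have e2 : 0 ≤ (B - x) / (2 * B) := div_nonneg (by linarith) (by linarith)
  have := convexOn_exp.2 (Set.mem_univ (B * y)) (Set.mem_univ (-B * y)) e1 e2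
    (show (B + x) / (2 * B) + (B - x) / (2 * B) = 1 by field_simp; ring)
  simp only [smul_eq_mul] at this
  have e3 : (B + x) / (2 * B) * (B * y) + (B - x) / (2 * B) * (-B * y) = x * y := by
    field_simp; ring
  rw [e3] at this
  exact this

lemma noise_step (m : MeasurableSpace Ω) [mΩ : MeasurableSpace Ω] (P : Measure Ω)
    [IsProbabilityMeasure P] (hm : m ≤ mΩ) (η x : Ω → ℝ) (hη : Measurable η)
    (hx : Measurable[m] x) (B σ : ℝ) (hB : 0 < B) (hxB : ∀ᵐ ω ∂P, |x ω| ≤ B)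
    (hint : ∀ s : ℝ, Integrable (fun ω => Real.exp (s * η ω)) P)
    (hsub : ∀ s : ℝ, ∀ᵐ ω ∂P, (P[fun ω' => Real.exp (s * η ω') | m]) ω ≤
        Real.exp (s ^ 2 * σ ^ 2 / 2))
    (s : ℝ) (Z : Ω → ℝ≥0∞) (hZ : Measurable[m] Z) :
    ∫⁻ ω, Z ω * ENNReal.ofReal (Real.exp (s * (x ω * η ω) - s ^ 2 * B ^ 2 * σ ^ 2 / 2)) ∂P
      ≤ ∫⁻ ω, Z ω ∂P := by
  set C := Real.exp (s ^ 2 * B ^ 2 * σ ^ 2 / 2) with hC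
  have hCpos : 0 < C := Real.exp_pos _
  set p : Ω → ℝ≥0∞ := fun ω => ENNReal.ofReal ((B + x ω) / (2 * B)) with hp
  set q : Ω → ℝ≥0∞ := fun ω => ENNReal.ofReal ((B - x ω) / (2 * B)) with hq
  have hpm : Measurable[m] p := by
    have : Measurable fun y : ℝ => ENNReal.ofReal ((B + y) / (2 * B)) := by fun_prop
    exact this.comp hx
  have hqm : Measurable[m] q := by
    have : Measurable fun y : ℝ => ENNReal.ofReal ((B - y) / (2 * B)) := by fun_prop
    exact this.comp hx
  have hZp : Measurable[m] fun ω => Z ω * p ω := hZ.mul hpm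
  have hZq : Measurable[m] fun ω => Z ω * q ω := hZ.mul hqm
  have key : ∀ s' : ℝ, s' ^ 2 = s ^ 2 * B ^ 2 → ∀ Z' : Ω → ℝ≥0∞, Measurable[m] Z' →
      ∫⁻ ω, Z' ω * ENNReal.ofReal (Real.exp (s' * η ω) * C⁻¹) ∂P ≤ ∫⁻ ω, Z' ω ∂P := by
    intro s' hs' Z' hZ'
    have h1 := condExp_step m P hm (fun ω => Real.exp (s' * η ω)) (by fun_prop)
      (fun ω => (Real.exp_pos _).le) (hint s') C hCpos.le
      (by simpa only [hs'] using hsub s') Z' hZ'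
    have hZ'' : Measurable Z' := hZ'.mono hm le_rfl
    calc ∫⁻ ω, Z' ω * ENNReal.ofReal (Real.exp (s' * η ω) * C⁻¹) ∂P
        = ∫⁻ ω, (Z' ω * ENNReal.ofReal (Real.exp (s' * η ω))) * ENNReal.ofReal C⁻¹ ∂P := by
          refine lintegral_congr fun ω => ?_
          rw [ENNReal.ofReal_mul (Real.exp_pos _).le, mul_assoc]
      _ = (∫⁻ ω, (Z' ω * ENNReal.ofReal (Real.exp (s' * η ω))) ∂P) * ENNReal.ofReal C⁻¹ := by
          rw [lintegral_mul_const]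
          exact hZ''.mul (by fun_prop)
      _ ≤ (ENNReal.ofReal C * ∫⁻ ω, Z' ω ∂P) * ENNReal.ofReal C⁻¹ := by gcongr
      _ = ∫⁻ ω, Z' ω ∂P := by
          rw [mul_right_comm, ← ENNReal.ofReal_mul hCpos.le, mul_inv_cancel₀ hCpos.ne']
          simp
  calc ∫⁻ ω, Z ω * ENNReal.ofReal (Real.exp (s * (x ω * η ω) - s ^ 2 * B ^ 2 * σ ^ 2 / 2)) ∂P
      ≤ ∫⁻ ω, ((Z ω * p ω) * ENNReal.ofReal (Real.exp ((s * B) * η ω) * C⁻¹) +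
          (Z ω * q ω) * ENNReal.ofReal (Real.exp ((-(s * B)) * η ω) * C⁻¹)) ∂P := by
        refine lintegral_mono_ae ?_
        filter_upwards [hxB] with ω hω
        obtain ⟨h1, h2⟩ := abs_le.1 hω
        rw [mul_assoc (Z ω), mul_assoc (Z ω), ← mul_add]
        gcongr
        have e1 : 0 ≤ (B + x ω) / (2 * B) := div_nonneg (by linarith) (by linarith)
        have e2 : 0 ≤ (B - x ω) / (2 * B) := div_nonneg (by linarith) (by linarith)
        rw [hp, hq]
        simp only
        rw [← ENNReal.ofReal_mul e1, ← ENNReal.ofReal_mul e2, ← ENNReal.ofReal_add (by positivity) (by positivity)]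
        refine ENNReal.ofReal_le_ofReal ?_
        rw [Real.exp_sub, ← hC, div_eq_mul_inv]
        have := exp_convex B (x ω) (s * η ω) hB hω
        rw [show x ω * (s * η ω) = s * (x ω * η ω) by ring,
          show B * (s * η ω) = s * B * η ω by ring,
          show -B * (s * η ω) = -(s * B) * η ω by ring] at this
        refine (mul_le_mul_of_nonneg_right this (by positivity : 0 ≤ C⁻¹)).trans_eq ?_
        ring
    _ = (∫⁻ ω, (Z ω * p ω) * ENNReal.ofReal (Real.exp ((s * B) * η ω) * C⁻¹) ∂P) +
          ∫⁻ ω, (Z ω * q ω) * ENNReal.ofReal (Real.exp ((-(s * B)) * η ω) * C⁻¹) ∂P := by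
        refine lintegral_add_left ?_ _
        exact (hZp.mono hm le_rfl).mul (by fun_prop)
    _ ≤ (∫⁻ ω, Z ω * p ω ∂P) + ∫⁻ ω, Z ω * q ω ∂P := by
        exact add_le_add (key _ (by ring) _ hZp) (key _ (by ring) _ hZq)
    _ = ∫⁻ ω, Z ω ∂P := by
        rw [← lintegral_add_left (hZp.mono hm le_rfl)]
        refine lintegral_congr_ae ?_
        filter_upwards [hxB] with ω hω
        obtain ⟨h1, h2⟩ := abs_le.1 hω
        have e1 : 0 ≤ (B + x ω) / (2 * B) := div_nonneg (by linarith) (by linarith)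
        have e2 : 0 ≤ (B - x ω) / (2 * B) := div_nonneg (by linarith) (by linarith)
        rw [← mul_add, hp, hq]
        simp only
        rw [← ENNReal.ofReal_add e1 e2]
        have : (B + x ω) / (2 * B) + (B - x ω) / (2 * B) = 1 := by field_simp; ring
        rw [this]; simp

lemma indep_step (m m' : MeasurableSpace Ω) [mΩ : MeasurableSpace Ω] (P : Measure Ω)
    [IsProbabilityMeasure P] (hm : m ≤ mΩ) (hm' : m' ≤ mΩ) (hind : Indep m' m P)
    (Y : Ω → ℝ≥0∞) (hY : Measurable[m'] Y) (hY1 : ∫⁻ ω, Y ω ∂P ≤ 1)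
    (Z : Ω → ℝ≥0∞) (hZ : Measurable[m] Z) :
    ∫⁻ ω, Z ω * Y ω ∂P ≤ ∫⁻ ω, Z ω ∂P := by
  rw [lintegral_mul_eq_lintegral_mul_lintegral_of_independent_measurableSpace hm hm' hind.symm hZ hY]
  calc _ ≤ (∫⁻ ω, Z ω ∂P) * 1 := by gcongr
    _ = _ := mul_one _

lemma hoeff_one [mΩ : MeasurableSpace Ω] (P : Measure Ω) [IsProbabilityMeasure P]
    (f : Ω → ℝ) (hf : Measurable f) (B : ℝ) (hB : 0 ≤ B) (hfB : ∀ᵐ ω ∂P, |f ω| ≤ B) (s : ℝ) :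
    ∫⁻ ω, ENNReal.ofReal (Real.exp (s * (f ω - ∫ ω', f ω' ∂P) - s ^ 2 * B ^ 2 / 2)) ∂P ≤ 1 := by
  have h := hasSubgaussianMGF_of_mem_Icc (μ := P) hf.aemeasurable (a := -B) (b := B)
    (by filter_upwards [hfB] with ω hω using abs_le.1 hω)
  have h1 := h.mgf_le s
  have hi := h.integrable_exp_mul s
  have e : (((‖B - -B‖₊ / 2) ^ 2 : NNReal) : ℝ) = B ^ 2 := by
    push_cast
    rw [Real.norm_eq_abs, abs_of_nonneg (by linarith)]
    ring
  rw [e] at h1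
  simp only [mgf] at h1
  have e2 : ∀ ω, Real.exp (s * (f ω - ∫ ω', f ω' ∂P) - s ^ 2 * B ^ 2 / 2) =
      Real.exp (s * (f ω - ∫ ω', f ω' ∂P)) * Real.exp (-(s ^ 2 * B ^ 2 / 2)) := by
    intro ω; rw [← Real.exp_add]; ring_nf
  simp only [e2]
  rw [← ofReal_integral_eq_lintegral_ofReal (hi.mul_const _)
    (Filter.Eventually.of_forall fun ω => by positivity), integral_mul_const]
  rw [← ENNReal.ofReal_one]
  refine ENNReal.ofReal_le_ofReal ?_
  calc _ ≤ Real.exp (B ^ 2 * s ^ 2 / 2) * Real.exp (-(s ^ 2 * B ^ 2 / 2)) := by gcongr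
    _ = 1 := by rw [← Real.exp_add]; ring_nf; simp

lemma bern_one [mΩ : MeasurableSpace Ω] (P : Measure Ω) [IsProbabilityMeasure P]
    (G : Set Ω) (hG : MeasurableSet G) (p : ℝ) (hp : 0 ≤ p) (hGp : P G ≤ ENNReal.ofReal p) :
    ∫⁻ ω, ENNReal.ofReal (Real.exp ((1/4) * G.indicator 1 ω - p * (29/100))) ∂P ≤ 1 := by
  have he : Real.exp (1/4) ≤ 129/100 := by
    have := Real.exp_bound_div_one_sub_of_interval (x := 1/8) (by norm_num) (by norm_num)
    have h2 : Real.exp (1/4) = Real.exp (1/8) ^ 2 := by rw [← Real.exp_nat_mul]; norm_num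
    have h4 := Real.exp_bound' (x := 1/4) (by norm_num) (by norm_num) (n := 4) (by norm_num)
    norm_num [Finset.sum_range_succ, Nat.factorial] at h4
    linarith
  have hpt : ∀ ω, ENNReal.ofReal (Real.exp ((1/4) * G.indicator 1 ω - p * (29/100))) ≤
      ENNReal.ofReal (Real.exp (-(p * (29/100)))) *
        (1 + ENNReal.ofReal (29/100) * G.indicator 1 ω) := by
    intro ω
    rw [sub_eq_neg_add, Real.exp_add, ENNReal.ofReal_mul (Real.exp_pos _).le]
    gcongr
    by_cases h : ω ∈ G
    · simp only [Set.indicator_of_mem h, Pi.one_apply, mul_one]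
      rw [← ENNReal.ofReal_one, ← ENNReal.ofReal_add (by norm_num) (by norm_num)]
      refine ENNReal.ofReal_le_ofReal ?_
      linarith
    · simp [Set.indicator_of_notMem h]
  calc _ ≤ ∫⁻ ω, ENNReal.ofReal (Real.exp (-(p * (29/100)))) *
        (1 + ENNReal.ofReal (29/100) * G.indicator 1 ω) ∂P := lintegral_mono hpt
    _ = ENNReal.ofReal (Real.exp (-(p * (29/100)))) * (1 + ENNReal.ofReal (29/100) * P G) := by
        have hmI : Measurable (G.indicator (1 : Ω → ℝ≥0∞)) := measurable_one.indicator hG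
        rw [lintegral_const_mul _ (by fun_prop), lintegral_add_left (by fun_prop),
          lintegral_const_mul _ hmI, lintegral_indicator_one hG]
        simp
    _ ≤ ENNReal.ofReal (Real.exp (-(p * (29/100)))) *
        (1 + ENNReal.ofReal (29/100) * ENNReal.ofReal p) := by gcongr
    _ ≤ 1 := by
        rw [← ENNReal.ofReal_one, ← ENNReal.ofReal_mul (by norm_num),
          ← ENNReal.ofReal_add (by norm_num) (by positivity), ← ENNReal.ofReal_mul (by positivity)]
        refine ENNReal.ofReal_le_ofReal ?_
        have := Real.add_one_le_exp (p * (29/100))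
        calc _ ≤ Real.exp (-(p * (29/100))) * Real.exp (p * (29/100)) := by gcongr; linarith
          _ = 1 := by rw [← Real.exp_add]; simp

lemma sum_range_Icc (f : ℕ → ℝ) (o n : ℕ) :
    ∑ i ∈ Finset.range n, f (o + 1 + i) = ∑ i ∈ Finset.Icc (o + 1) (o + n), f i := by
  induction n with
  | zero => simp
  | succ n ih =>
    rw [Finset.sum_range_succ, ih, ← Nat.add_assoc o n 1, Finset.sum_Icc_succ_top (by omega)]
    congr 2; omega

section meas
variable [mΩ : MeasurableSpace Ω] {d K : ℕ} (X : ℕ → Ω → Fin K → Fin d → ℝ)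
    (act : ℕ → Ω → Fin K) (r : ℕ → Ω → ℝ)

lemma sigF_le (hX : ∀ t, Measurable (X t)) (ha : ∀ t, Measurable (act t))
    (hr : ∀ t, Measurable (r t)) (t : ℕ) : sigF X act r t ≤ mΩ := by
  unfold sigF
  refine sup_le (sup_le ?_ ?_) ?_
  · exact iSup₂_le fun i _ => (hX i).comap_le
  · exact iSup₂_le fun i _ => (ha i).comap_le
  · exact iSup₂_le fun i _ => (hr i).comap_le

lemma sigFplus_le (hX : ∀ t, Measurable (X t)) (ha : ∀ t, Measurable (act t))
    (hr : ∀ t, Measurable (r t)) (t : ℕ) : sigFplus X act r t ≤ mΩ := by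
  unfold sigFplus
  refine sup_le (sup_le ?_ ?_) ?_
  · exact iSup₂_le fun i _ => (hX i).comap_le
  · exact iSup₂_le fun i _ => (ha i).comap_le
  · exact iSup₂_le fun i _ => (hr i).comap_le

lemma sigF_mono : Monotone (sigF X act r) := by
  intro s t hst
  unfold sigF
  refine sup_le_sup (sup_le_sup ?_ ?_) ?_
  · exact biSup_mono fun i hi => by simp at hi ⊢; omega
  · exact biSup_mono fun i hi => by simp at hi ⊢; omega
  · exact biSup_mono fun i hi => by simp at hi ⊢; omega

lemma sigFplus_mono : Monotone (sigFplus X act r) := by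
  intro s t hst
  unfold sigFplus
  refine sup_le_sup (sup_le_sup ?_ ?_) ?_
  · exact biSup_mono fun i hi => by simp at hi ⊢; omega
  · exact biSup_mono fun i hi => by simp at hi ⊢; omega
  · exact biSup_mono fun i hi => by simp at hi ⊢; omega

lemma X_meas_sigF {i t : ℕ} (h1 : 1 ≤ i) (h2 : i ≤ t) : Measurable[sigF X act r t] (X i) := by
  refine Measurable.of_comap_le ?_
  refine le_trans ?_ (le_sup_left.trans le_sup_left)
  exact le_iSup₂_of_le (f := fun i (_ : i ∈ Finset.Icc 1 t) =>
    MeasurableSpace.comap (X i) inferInstance) i (by simp; omega) le_rfl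

lemma act_meas_sigF {i t : ℕ} (h1 : 1 ≤ i) (h2 : i ≤ t) : Measurable[sigF X act r t] (act i) := by
  refine Measurable.of_comap_le ?_
  refine le_trans ?_ (le_sup_right.trans le_sup_left)
  exact le_iSup₂_of_le (f := fun i (_ : i ∈ Finset.Icc 1 t) =>
    MeasurableSpace.comap (act i) inferInstance) i (by simp; omega) le_rfl

lemma r_meas_sigF {i t : ℕ} (h1 : 1 ≤ i) (h2 : i + 1 ≤ t) : Measurable[sigF X act r t] (r i) := by
  refine Measurable.of_comap_le ?_
  refine le_trans ?_ le_sup_right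
  exact le_iSup₂_of_le (f := fun i (_ : i ∈ Finset.Icc 1 (t-1)) =>
    MeasurableSpace.comap (r i) inferInstance) i (by simp; omega) le_rfl

lemma X_meas_sigFplus {i t : ℕ} (h1 : 1 ≤ i) (h2 : i ≤ t) :
    Measurable[sigFplus X act r t] (X i) := by
  refine Measurable.of_comap_le ?_
  refine le_trans ?_ (le_sup_left.trans le_sup_left)
  exact le_iSup₂_of_le (f := fun i (_ : i ∈ Finset.Icc 1 t) =>
    MeasurableSpace.comap (X i) inferInstance) i (by simp; omega) le_rfl
end meas

lemma sel_meas {d K : ℕ} (m : MeasurableSpace Ω) (X : Ω → Fin K → Fin d → ℝ) (a : Ω → Fin K)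
    (hX : Measurable X) (ha : Measurable a) (j : Fin d) :
    Measurable fun ω => X ω (a ω) j := by
  have : (fun ω => X ω (a ω) j) = fun ω => ∑ k, if a ω = k then X ω k j else 0 := by
    funext ω; simp
  rw [this]
  refine Finset.measurable_sum _ fun k _ => ?_
  refine Measurable.ite (ha (measurableSet_singleton k)) ?_ measurable_const
  exact (measurable_pi_apply j).comp ((measurable_pi_apply k).comp hX)

section ev
variable [mΩ : MeasurableSpace Ω] {P : Measure Ω} {d K : ℕ}

lemma reward_meas (A : FSWLasso Ω P d K) (t : ℕ) :
    Measurable (reward A.X A.act A.βstar A.η t) := by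
  unfold reward
  refine Measurable.add ?_ (A.measη t)
  simp only [dotProduct]
  exact Finset.measurable_sum _ fun j _ =>
    (sel_meas mΩ _ _ (A.measX t) (A.measAct t) j).mul_const _

lemma eta_meas_sigF (A : FSWLasso Ω P d K) {i t : ℕ} (h1 : 1 ≤ i) (h2 : i + 1 ≤ t) :
    Measurable[sigF A.X A.act (reward A.X A.act A.βstar A.η) t] (A.η i) := by
  have h := r_meas_sigF A.X A.act (reward A.X A.act A.βstar A.η) h1 h2
  have hx : Measurable[sigF A.X A.act (reward A.X A.act A.βstar A.η) t]
      (fun ω => A.X i ω (A.act i ω) ⬝ᵥ A.βstar) := by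
    simp only [dotProduct]
    exact Finset.measurable_sum _ fun j _ =>
      (sel_meas _ _ _ (X_meas_sigF A.X A.act _ h1 (by omega))
        (act_meas_sigF A.X A.act _ h1 (by omega)) j).mul_const _
  have e : A.η i = fun ω => reward A.X A.act A.βstar A.η i ω - A.X i ω (A.act i ω) ⬝ᵥ A.βstar := by
    funext ω; simp [reward]
  rw [e]
  exact h.sub hx

lemma noise_line (A : FSWLasso Ω P d K) (o : ℕ) (j : Fin d) (s ℓ : ℝ) :
    P {ω | ∃ n : ℕ, ℓ ≤ s * ∑ i ∈ Finset.Icc (o + 1) (o + n), A.X i ω (A.act i ω) j * A.η i ω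
      - n * (s ^ 2 * A.xmax ^ 2 * A.σ ^ 2 / 2)} ≤ ENNReal.ofReal (Real.exp (-ℓ)) := by
  have := A.probMeas
  set r := reward A.X A.act A.βstar A.η with hr
  have hsel : ∀ i t, 1 ≤ i → i ≤ t → Measurable[sigF A.X A.act r t]
      fun ω => A.X i ω (A.act i ω) j := fun i t h1 h2 =>
    sel_meas _ _ _ (X_meas_sigF A.X A.act _ h1 h2) (act_meas_sigF A.X A.act _ h1 h2) j
  have h := ville_real P (fun i => sigF A.X A.act r (o + 1 + i))
    (fun i => sigF_le _ _ _ A.measX A.measAct (reward_meas A) _)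
    (fun i i' h => sigF_mono _ _ _ (by omega))
    (fun i ω => s * (A.X (o+1+i) ω (A.act (o+1+i) ω) j * A.η (o+1+i) ω) -
      s ^ 2 * A.xmax ^ 2 * A.σ ^ 2 / 2)
    (fun i => by
      have h1 := hsel (o+1+i) (o+1+(i+1)) (by omega) (by omega)
      have h2 := eta_meas_sigF A (i := o+1+i) (t := o+1+(i+1)) (by omega) (by omega)
      exact ((h1.mul h2).const_mul s).sub_const _)
    (fun i Z hZ => noise_step _ P (sigF_le _ _ _ A.measX A.measAct (reward_meas A) _) _ _
      (A.measη _) (hsel (o+1+i) (o+1+i) (by omega) le_rfl) A.xmax A.σ A.hxmax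
      (by filter_upwards [A.bddX (o+1+i) (by omega)] with ω hω using hω _ _)
      (A.noiseInt _ (by omega)) (A.subG _ (by omega)) s Z hZ) ℓ
  refine le_trans (measure_mono ?_) h
  rintro ω ⟨n, hn⟩
  refine ⟨n, hn.trans_eq ?_⟩
  rw [Finset.sum_sub_distrib, ← Finset.mul_sum,
    sum_range_Icc (fun i => A.X i ω (A.act i ω) j * A.η i ω)]
  simp

def optF {d K : ℕ} (β : Fin d → ℝ) (a b : Fin d) (x : Fin K → Fin d → ℝ) : ℝ :=
  ∑ k, if (∀ l, l ≠ k → x l ⬝ᵥ β < x k ⬝ᵥ β) then x k a * x k b else 0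

lemma dot_meas {d K : ℕ} (β : Fin d → ℝ) (k : Fin K) :
    Measurable fun x : Fin K → Fin d → ℝ => x k ⬝ᵥ β := by
  simp only [dotProduct]
  fun_prop

lemma optF_meas {d K : ℕ} (β : Fin d → ℝ) (a b : Fin d) : Measurable (optF (K := K) β a b) := by
  unfold optF
  refine Finset.measurable_sum _ fun k _ => ?_
  refine Measurable.ite ?_ (by fun_prop) measurable_const
  have : {x : Fin K → Fin d → ℝ | ∀ l, l ≠ k → x l ⬝ᵥ β < x k ⬝ᵥ β} =
      ⋂ l, {x | l ≠ k → x l ⬝ᵥ β < x k ⬝ᵥ β} := by ext x; simp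
  rw [this]
  refine MeasurableSet.iInter fun l => ?_
  by_cases h : l = k
  · simp [h]
  · simp only [ne_eq, h, not_false_eq_true, forall_const]
    exact measurableSet_lt (dot_meas β l) (dot_meas β k)

lemma optF_eq {d K : ℕ} (β : Fin d → ℝ) (a b : Fin d) (x : Fin K → Fin d → ℝ) (k : Fin K)
    (h : ∀ l, l ≠ k → x l ⬝ᵥ β < x k ⬝ᵥ β) : optF β a b x = x k a * x k b := by
  unfold optF
  rw [Finset.sum_eq_single k]
  · rw [if_pos h]
  · intro k' _ hk'
    rw [if_neg]
    intro h'
    exact absurd (h k' hk') (not_lt.2 (h' k (Ne.symm hk')).le)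
  · simp

lemma gap_le {d K : ℕ} (β : Fin d → ℝ) (x : Fin K → Fin d → ℝ) (a k : Fin K) (h : k ≠ a) :
    gapOf β x a ≤ x a ⬝ᵥ β - x k ⬝ᵥ β := by
  unfold gapOf
  have := le_ciSup (f := fun k : {k : Fin K // k ≠ a} => x k.1 ⬝ᵥ β)
    (Set.finite_range _).bddAbove ⟨k, h⟩
  simp only at this
  linarith

lemma gap_pos (A : FSWLasso Ω P d K) (t : ℕ) (ht : 1 ≤ t) :
    ∀ᵐ ω ∂P, 0 < gapOf A.βstar (A.X t ω) (A.astar t ω) := by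
  rw [ae_iff]
  refine le_antisymm ?_ zero_le
  refine ENNReal.le_of_forall_pos_le_add ?_
  intro ε hε _
  rw [zero_add]
  have hε' : (0:ℝ) < ε := hε
  set h := A.Δstar * (ε : ℝ) ^ (1 / A.α) with hh
  have hpos : 0 < h := mul_pos A.hΔstar (Real.rpow_pos_of_pos hε' _)
  calc _ ≤ P {ω | gapOf A.βstar (A.X t ω) (A.astar t ω) ≤ h} := by
        refine measure_mono fun ω hω => ?_
        have hω' : ¬ 0 < gapOf A.βstar (A.X t ω) (A.astar t ω) := hω
        show gapOf A.βstar (A.X t ω) (A.astar t ω) ≤ h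
        linarith
    _ ≤ _ := A.margin t ht h hpos
    _ = ε := by
        have : h / A.Δstar = (ε : ℝ) ^ (1 / A.α) := by
          rw [hh]; field_simp [A.hΔstar.ne']
        rw [this, ← Real.rpow_mul hε'.le, one_div_mul_cancel A.hα.ne', Real.rpow_one]
        simp

lemma optF_ae (A : FSWLasso Ω P d K) (t : ℕ) (ht : 1 ≤ t) :
    ∀ᵐ ω ∂P, ∀ a b, optF A.βstar a b (A.X t ω) =
      A.X t ω (A.astar t ω) a * A.X t ω (A.astar t ω) b := by
  filter_upwards [gap_pos A t ht] with ω hω a b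
  refine optF_eq _ _ _ _ _ fun l hl => ?_
  have := gap_le A.βstar (A.X t ω) _ _ hl
  linarith

def optSig (A : FSWLasso Ω P d K) : Matrix (Fin d) (Fin d) ℝ :=
  Matrix.of fun a b => ∫ x, optF A.βstar a b x ∂A.DX

lemma optSig_eq (A : FSWLasso Ω P d K) (t : ℕ) (ht : 1 ≤ t) (a b : Fin d) :
    ∫ ω, optF A.βstar a b (A.X t ω) ∂P = optSig A a b := by
  rw [optSig, Matrix.of_apply, ← A.ident t ht,
    integral_map (A.measX t).aemeasurable (optF_meas _ _ _).aestronglyMeasurable]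

lemma gram_eq (A : FSWLasso Ω P d K) (t : ℕ) (ht : 1 ≤ t) :
    gram P (fun ω => A.X t ω (A.astar t ω)) = optSig A := by
  ext a b
  rw [← optSig_eq A t ht, gram, Matrix.of_apply]
  refine integral_congr_ae ?_
  filter_upwards [optF_ae A t ht] with ω hω
  exact (hω a b).symm

lemma opt_line (A : FSWLasso Ω P d K) (o : ℕ) (a b : Fin d) (s ℓ : ℝ) :
    P {ω | ∃ n : ℕ, ℓ ≤ s * (∑ i ∈ Finset.Icc (o + 1) (o + n), optF A.βstar a b (A.X i ω)
      - n * optSig A a b) - n * (s ^ 2 * (A.xmax ^ 2) ^ 2 / 2)} ≤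
      ENNReal.ofReal (Real.exp (-ℓ)) := by
  have := A.probMeas
  set r := reward A.X A.act A.βstar A.η with hr
  have h := ville_real P (fun i => sigFplus A.X A.act r (o + i))
    (fun i => sigFplus_le _ _ _ A.measX A.measAct (reward_meas A) _)
    (fun i i' h => sigFplus_mono _ _ _ (by omega))
    (fun i ω => s * (optF A.βstar a b (A.X (o+1+i) ω) - optSig A a b) -
      s ^ 2 * (A.xmax ^ 2) ^ 2 / 2)
    (fun i => by
      have h1 := X_meas_sigFplus A.X A.act r (i := o+1+i) (t := o+(i+1)) (by omega) (by omega)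
      exact ((((optF_meas A.βstar a b).comp h1).sub_const _).const_mul s).sub_const _)
    (fun i Z hZ => by
      refine indep_step (sigFplus A.X A.act r (o + i))
        (MeasurableSpace.comap (A.X (o+1+i)) inferInstance) P
        (sigFplus_le _ _ _ A.measX A.measAct (reward_meas A) _) (A.measX _).comap_le ?_ _ ?_ ?_ Z hZ
      · have := A.indepX (o+1+i) (by omega)
        rwa [show o + 1 + i - 1 = o + i by omega] at this
      · have h1 := comap_measurable (m := inferInstance) (A.X (o+1+i))
        have h2 := ((((optF_meas A.βstar a b).comp h1).sub_const (optSig A a b)).const_mul s).sub_const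
          (s ^ 2 * (A.xmax ^ 2) ^ 2 / 2)
        exact (ENNReal.measurable_ofReal.comp Real.measurable_exp).comp h2
      · rw [← optSig_eq A (o+1+i) (by omega)]
        refine hoeff_one P (fun ω => optF A.βstar a b (A.X (o+1+i) ω))
          ((optF_meas A.βstar a b).comp (A.measX _)) (A.xmax ^ 2) (by positivity) ?_ s
        filter_upwards [optF_ae A (o+1+i) (by omega), A.bddX (o+1+i) (by omega)] with ω h1 h2
        rw [h1, abs_mul, sq]
        exact mul_le_mul (h2 _ _) (h2 _ _) (abs_nonneg _) A.hxmax.le) ℓ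
  refine le_trans (measure_mono ?_) h
  rintro ω ⟨n, hn⟩
  refine ⟨n, hn.trans_eq ?_⟩
  rw [Finset.sum_sub_distrib, ← Finset.mul_sum, Finset.sum_sub_distrib,
    sum_range_Icc (fun i => optF A.βstar a b (A.X i ω))]
  simp

def Gset {d : ℕ} (K : ℕ) (β : Fin d → ℝ) (h : ℝ) : Set (Fin K → Fin d → ℝ) :=
  {x | ∃ k k', k' ≠ k ∧ (∀ l, x l ⬝ᵥ β ≤ x k ⬝ᵥ β) ∧ x k ⬝ᵥ β - x k' ⬝ᵥ β ≤ h}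

lemma Gset_meas {d : ℕ} (K : ℕ) (β : Fin d → ℝ) (h : ℝ) : MeasurableSet (Gset K β h) := by
  have : Gset K β h = ⋃ k, ⋃ k', ⋃ (_ : k' ≠ k), ((⋂ l, {x | x l ⬝ᵥ β ≤ x k ⬝ᵥ β}) ∩
      {x | x k ⬝ᵥ β - x k' ⬝ᵥ β ≤ h}) := by
    ext x
    simp only [Gset, Set.mem_iUnion, Set.mem_inter_iff, Set.mem_iInter, Set.mem_ofPred_eq,
      exists_prop]
  rw [this]
  refine MeasurableSet.iUnion fun k => MeasurableSet.iUnion fun k' => MeasurableSet.iUnion fun _ => ?_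
  refine MeasurableSet.inter (MeasurableSet.iInter fun l => ?_) ?_
  · exact measurableSet_le (dot_meas β l) (dot_meas β k)
  · exact measurableSet_le ((dot_meas β k).sub (dot_meas β k')) measurable_const

lemma Gind_meas {Ω : Type*} {d K : ℕ} (m : MeasurableSpace Ω) (X : Ω → Fin K → Fin d → ℝ)
    (β : Fin d → ℝ) (h : ℝ) (hX : Measurable X) :
    Measurable ((X ⁻¹' Gset K β h).indicator (1 : Ω → ℝ)) :=
  measurable_one.indicator (hX (Gset_meas K β h))

lemma Gset_prob (A : FSWLasso Ω P d K) (h : ℝ) (hh : 0 < h) (t : ℕ) (ht : 1 ≤ t) :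
    P (A.X t ⁻¹' Gset K A.βstar h) ≤ ENNReal.ofReal ((h / A.Δstar) ^ A.α) := by
  refine le_trans (measure_mono ?_) (A.margin t ht h hh)
  rintro ω ⟨k, k', hk, hmax, hle⟩
  show gapOf A.βstar (A.X t ω) (A.astar t ω) ≤ h
  have ho := A.optAstar t ω
  by_cases hs : k = A.astar t ω
  · subst hs
    exact (gap_le _ _ _ _ hk).trans hle
  · have h1 := gap_le A.βstar (A.X t ω) _ _ hs
    have h2 := hmax (A.astar t ω)
    linarith

lemma bern_line (A : FSWLasso Ω P d K) (o : ℕ) (h : ℝ) (hh : 0 < h) (ℓ : ℝ) :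
    P {ω | ∃ n : ℕ, ℓ ≤ (1/4) * ∑ i ∈ Finset.Icc (o + 1) (o + n),
      (A.X i ⁻¹' Gset K A.βstar h).indicator (1 : Ω → ℝ) ω
      - n * ((h / A.Δstar) ^ A.α * (29/100))} ≤
      ENNReal.ofReal (Real.exp (-ℓ)) := by
  have := A.probMeas
  set r := reward A.X A.act A.βstar A.η with hr
  have h := ville_real P (fun i => sigFplus A.X A.act r (o + i))
    (fun i => sigFplus_le _ _ _ A.measX A.measAct (reward_meas A) _)
    (fun i i' h => sigFplus_mono _ _ _ (by omega))
    (fun i ω => (1/4) * ((A.X (o+1+i) ⁻¹' Gset K A.βstar h).indicator (1 : Ω → ℝ) ω) -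
      (h / A.Δstar) ^ A.α * (29/100))
    (fun i => by
      have h1 := X_meas_sigFplus A.X A.act r (i := o+1+i) (t := o+(i+1)) (by omega) (by omega)
      exact ((Gind_meas _ _ A.βstar h h1).const_mul _).sub_const _)
    (fun i Z hZ => by
      refine indep_step (sigFplus A.X A.act r (o + i))
        (MeasurableSpace.comap (A.X (o+1+i)) inferInstance) P
        (sigFplus_le _ _ _ A.measX A.measAct (reward_meas A) _) (A.measX _).comap_le ?_ _ ?_ ?_ Z hZ
      · have := A.indepX (o+1+i) (by omega)
        rwa [show o + 1 + i - 1 = o + i by omega] at this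
      · have h1 := comap_measurable (m := inferInstance) (A.X (o+1+i))
        have h2 := ((Gind_meas _ _ A.βstar h h1).const_mul (1/4)).sub_const ((h / A.Δstar) ^ A.α * (29/100))
        exact (ENNReal.measurable_ofReal.comp Real.measurable_exp).comp h2
      · exact bern_one P _ (A.measX _ (Gset_meas K A.βstar h)) _
          (Real.rpow_nonneg (div_nonneg hh.le A.hΔstar.le) _) (Gset_prob A h hh _ (by omega))) ℓ
  refine le_trans (measure_mono ?_) h
  rintro ω ⟨n, hn⟩
  refine ⟨n, hn.trans_eq ?_⟩
  rw [Finset.sum_sub_distrib, ← Finset.mul_sum]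
  rw [sum_range_Icc (fun i => (A.X i ⁻¹' Gset K A.βstar _).indicator (1 : Ω → ℝ) ω)]
  simp
end ev

def LL (d : ℕ) (δ x : ℝ) : ℝ := Real.log (7 * d * (Real.log (2 * x)) ^ 2 / δ)

lemma log2_sq : (0.48 : ℝ) ≤ Real.log 2 ^ 2 := by
  have := Real.log_two_gt_d9
  nlinarith

lemma log_2x_ge {x : ℝ} (hx : 1 ≤ x) : Real.log 2 ≤ Real.log (2 * x) :=
  Real.log_le_log (by norm_num) (by linarith)

lemma LL_arg_ge {d : ℕ} (hd : 1 ≤ d) {δ : ℝ} (hδ : 0 < δ) {x : ℝ} (hx : 1 ≤ x) :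
    2 * d / δ ≤ 7 * d * (Real.log (2 * x)) ^ 2 / δ := by
  have h1 := log_2x_ge hx
  have h2 := log2_sq
  have h3 := Real.log_two_gt_d9
  have h4 : (0.48:ℝ) ≤ Real.log (2 * x) ^ 2 := by nlinarith
  have hd' : (1:ℝ) ≤ d := by exact_mod_cast hd
  refine div_le_div_of_nonneg_right ?_ hδ.le
  nlinarith

lemma two_d_ge {d : ℕ} (hd : 1 ≤ d) {δ : ℝ} (hδ : 0 < δ) (hδ1 : δ ≤ 1) : (2:ℝ) ≤ 2 * d / δ := by
  have hd' : (1:ℝ) ≤ d := by exact_mod_cast hd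
  rw [le_div_iff₀ hδ]; nlinarith

lemma LL_ge {d : ℕ} (hd : 1 ≤ d) {δ : ℝ} (hδ : 0 < δ) (hδ1 : δ ≤ 1) {x : ℝ} (hx : 1 ≤ x) :
    Real.log (2 * d / δ) ≤ LL d δ x :=
  Real.log_le_log (by linarith [two_d_ge hd hδ hδ1]) (LL_arg_ge hd hδ hx)

lemma log_two_d_pos {d : ℕ} (hd : 1 ≤ d) {δ : ℝ} (hδ : 0 < δ) (hδ1 : δ ≤ 1) :
    0 < Real.log (2 * d / δ) := Real.log_pos (by linarith [two_d_ge hd hδ hδ1])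

lemma LL_pos {d : ℕ} (hd : 1 ≤ d) {δ : ℝ} (hδ : 0 < δ) (hδ1 : δ ≤ 1) {x : ℝ} (hx : 1 ≤ x) :
    0 < LL d δ x := (log_two_d_pos hd hδ hδ1).trans_le (LL_ge hd hδ hδ1 hx)

lemma LL_mono {d : ℕ} (hd : 1 ≤ d) {δ : ℝ} (hδ : 0 < δ) (hδ1 : δ ≤ 1) {x y : ℝ} (hx : 1 ≤ x)
    (hxy : x ≤ y) : LL d δ x ≤ LL d δ y := by
  have h1 := log_2x_ge hx
  have h3 := Real.log_two_gt_d9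
  refine Real.log_le_log (by linarith [two_d_ge hd hδ hδ1, LL_arg_ge hd hδ hx]) ?_
  have : Real.log (2 * x) ≤ Real.log (2 * y) := Real.log_le_log (by linarith) (by linarith)
  gcongr
  linarith

lemma two34_ge : (1.68 : ℝ) ≤ (2:ℝ) ^ ((3:ℝ)/4) := by
  have h : ((2:ℝ) ^ ((3:ℝ)/4)) ^ 4 = 8 := by
    rw [← Real.rpow_natCast, ← Real.rpow_mul (by norm_num)]; norm_num
  by_contra hc
  push Not at hc
  have h0 : 0 ≤ (2:ℝ) ^ ((3:ℝ)/4) := by positivity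
  have := pow_lt_pow_left₀ hc h0 (n := 4) (by norm_num)
  rw [h] at this; norm_num at this

lemma two34_le : (2:ℝ) ^ ((3:ℝ)/4) ≤ 1.682 := by
  have h : ((2:ℝ) ^ ((3:ℝ)/4)) ^ 4 = 8 := by
    rw [← Real.rpow_natCast, ← Real.rpow_mul (by norm_num)]; norm_num
  by_contra hc
  push Not at hc
  have := pow_lt_pow_left₀ hc (by norm_num) (n := 4) (by norm_num)
  rw [h] at this; norm_num at this

lemma prob_pair [MeasurableSpace Ω] (P : Measure Ω) (S : Set Ω) (S1 S2 : Set Ω) (p : ℝ)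
    (hp : 0 ≤ p)
    (h : S ⊆ S1 ∪ S2) (h1 : P S1 ≤ ENNReal.ofReal p) (h2 : P S2 ≤ ENNReal.ofReal p) :
    P S ≤ ENNReal.ofReal (2 * p) := by
  calc P S ≤ P (S1 ∪ S2) := measure_mono h
    _ ≤ P S1 + P S2 := measure_union_le _ _
    _ ≤ ENNReal.ofReal p + ENNReal.ofReal p := by gcongr
    _ = _ := by rw [← ENNReal.ofReal_add hp hp]; ring_nf

lemma prob_fin [MeasurableSpace Ω] (P : Measure Ω) {d : ℕ} (S : Fin d → Set Ω) (p : ℝ) (hp : 0 ≤ p)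
    (h : ∀ j, P (S j) ≤ ENNReal.ofReal p) : P (⋃ j, S j) ≤ ENNReal.ofReal (d * p) := by
  calc P (⋃ j, S j) ≤ ∑ j, P (S j) := measure_iUnion_fintype_le _ _
    _ ≤ ∑ _j : Fin d, ENNReal.ofReal p := Finset.sum_le_sum fun j _ => h j
    _ = _ := by
      rw [Finset.sum_const, Finset.card_univ, Fintype.card_fin, nsmul_eq_mul,
        ENNReal.ofReal_mul (by positivity)]
      simp

lemma prob_nat [MeasurableSpace Ω] (P : Measure Ω) (S : ℕ → Set Ω) (p : ℕ → ℝ) (hp : ∀ k, 0 ≤ p k)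
    (hs : Summable p)
    (h : ∀ k, P (S k) ≤ ENNReal.ofReal (p k)) : P (⋃ k, S k) ≤ ENNReal.ofReal (∑' k, p k) := by
  calc P (⋃ k, S k) ≤ ∑' k, P (S k) := measure_iUnion_le _
    _ ≤ ∑' k, ENNReal.ofReal (p k) := ENNReal.tsum_le_tsum h
    _ = _ := (ENNReal.ofReal_tsum_of_nonneg hp hs).symm

section ev
variable [mΩ : MeasurableSpace Ω] {P : Measure Ω} {d K : ℕ}

/-- forced sampling noise -/
lemma event1 (A : FSWLasso Ω P d K) (hd : 1 ≤ d) (δ : ℝ) (hδ : 0 < δ) (hδ1 : δ ≤ 1) :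
    P {ω | ¬ ∀ j, |∑ i ∈ Finset.Icc 1 A.M0, A.X i ω (A.act i ω) j * A.η i ω| ≤
      A.σ * A.xmax * Real.sqrt (2 * A.M0 * Real.log (2 * d / δ))} ≤ ENNReal.ofReal δ := by
  have hd' : (0:ℝ) < d := by exact_mod_cast hd
  set ℓ := Real.log (2 * d / δ) with hℓ
  have hℓ0 : 0 < ℓ := log_two_d_pos hd hδ hδ1
  have hex : Real.exp (-ℓ) = δ / (2 * d) := by
    rw [Real.exp_neg, hℓ, Real.exp_log (by positivity), inv_div]
  have hσx : 0 < A.σ * A.xmax := mul_pos A.hσ A.hxmax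
  set u := Real.sqrt (2 * ℓ / A.M0) with hu
  set s := u / (A.σ * A.xmax) with hs
  rcases Nat.eq_zero_or_pos A.M0 with hM | hM
  · have : {ω | ¬ ∀ j, |∑ i ∈ Finset.Icc 1 A.M0, A.X i ω (A.act i ω) j * A.η i ω| ≤
      A.σ * A.xmax * Real.sqrt (2 * A.M0 * ℓ)} = ∅ := by
      ext ω; simp [hM]
    rw [this]; simp
  have hM' : (0:ℝ) < A.M0 := by exact_mod_cast hM
  have hu0 : 0 < u := Real.sqrt_pos.2 (by positivity)
  have hu2 : u ^ 2 = 2 * ℓ / A.M0 := Real.sq_sqrt (by positivity)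
  have hs0 : 0 < s := div_pos hu0 hσx
  have hsq : Real.sqrt (2 * A.M0 * ℓ) = A.M0 * u := by
    rw [Real.sqrt_eq_iff_mul_self_eq (by positivity) (by positivity)]
    have : (A.M0 * u) * (A.M0 * u) = A.M0 ^ 2 * u ^ 2 := by ring
    rw [this, hu2]; field_simp
  have hs2 : A.M0 * (s ^ 2 * A.xmax ^ 2 * A.σ ^ 2 / 2) = ℓ := by
    have : s ^ 2 * A.xmax ^ 2 * A.σ ^ 2 = u ^ 2 := by
      have h1 := A.hσ.ne'; have h2 := A.hxmax.ne'
      rw [hs]; field_simp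
    rw [this, hu2]; field_simp
  have hs3 : s * (A.σ * A.xmax * (A.M0 * u)) = 2 * ℓ := by
    have : s * (A.σ * A.xmax * (A.M0 * u)) = A.M0 * u ^ 2 := by
      have h1 := A.hσ.ne'; have h2 := A.hxmax.ne'
      rw [hs]; field_simp
    rw [this, hu2]; field_simp
  have key := fun j => prob_pair P
    {ω | ¬ |∑ i ∈ Finset.Icc 1 A.M0, A.X i ω (A.act i ω) j * A.η i ω| ≤
      A.σ * A.xmax * Real.sqrt (2 * A.M0 * ℓ)} _ _ (δ / (2 * d)) (by positivity) ?_
      ((noise_line A 0 j s ℓ).trans_eq (by rw [hex])) ((noise_line A 0 j (-s) ℓ).trans_eq (by rw [hex]))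
  · have := prob_fin P _ _ (by positivity) key
    have e : (d:ℝ) * (2 * (δ / (2 * d))) = δ := by field_simp
    rw [e] at this
    refine le_trans (measure_mono ?_) this
    intro ω hω
    have hω' : ¬ ∀ j, |∑ i ∈ Finset.Icc 1 A.M0, A.X i ω (A.act i ω) j * A.η i ω| ≤
      A.σ * A.xmax * Real.sqrt (2 * A.M0 * ℓ) := hω
    push Not at hω'
    obtain ⟨j, hj⟩ := hω'
    rw [Set.mem_iUnion]
    exact ⟨j, not_le.2 hj⟩
  · intro ω hω
    have hω' := not_le.1 (show ¬ _ from hω)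
    rw [hsq] at hω'
    rcases lt_abs.1 hω' with h | h
    · left
      refine ⟨A.M0, ?_⟩
      have := mul_lt_mul_of_pos_left h hs0
      rw [hs3] at this
      rw [hs2]; simp only [zero_add]; linarith
    · right
      refine ⟨A.M0, ?_⟩
      have := mul_lt_mul_of_pos_left h hs0
      rw [hs3] at this
      rw [neg_sq, hs2]; simp only [zero_add]; linarith

/-- one dyadic block, one sign -/
lemma block_real (ℓ L S σx : ℝ) (n k : ℕ) (hℓ : 0 < ℓ) (hL : ℓ ≤ L) (hσx : 0 < σx)
    (h1 : 2 ^ k ≤ n) (h2 : n < 2 ^ (k + 1))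
    (hS : σx * ((2:ℝ) ^ ((3:ℝ)/4) * Real.sqrt (n * L)) < S) :
    ℓ ≤ Real.sqrt (2 * ℓ / 2 ^ k) / σx * S -
      n * ((Real.sqrt (2 * ℓ / 2 ^ k) / σx) ^ 2 * σx ^ 2 / 2) := by
  set u := Real.sqrt (2 * ℓ / 2 ^ k) with hu
  have hk : (0:ℝ) < 2 ^ k := by positivity
  have hu0 : 0 < u := Real.sqrt_pos.2 (by positivity)
  have hu2 : u ^ 2 = 2 * ℓ / 2 ^ k := Real.sq_sqrt (by positivity)
  have h1' : (2:ℝ) ^ k ≤ n := by exact_mod_cast h1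
  have h2' : (n:ℝ) < 2 * 2 ^ k := by
    have : (n:ℝ) < 2 ^ (k+1) := by exact_mod_cast h2
    rw [pow_succ] at this; linarith
  set ρ := (n:ℝ) / 2 ^ k with hρ
  have hρ1 : 1 ≤ ρ := by rw [hρ, le_div_iff₀ hk]; linarith
  have hρ2 : ρ ≤ 2 := by rw [hρ, div_le_iff₀ hk]; linarith
  have hnρ : (n:ℝ) = ρ * 2 ^ k := by rw [hρ]; field_simp
  have e1 : n * ((u / σx) ^ 2 * σx ^ 2 / 2) = ρ * ℓ := by
    rw [div_pow, hu2, hnρ]; field_simp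
  rw [e1]
  have e2 : u * Real.sqrt (n * ℓ) = ℓ * Real.sqrt (2 * ρ) := by
    rw [hu, ← Real.sqrt_mul (by positivity), hnρ]
    have : 2 * ℓ / 2 ^ k * (ρ * 2 ^ k * ℓ) = ℓ ^ 2 * (2 * ρ) := by field_simp
    rw [this, Real.sqrt_mul (by positivity), Real.sqrt_sq hℓ.le]
  have e3 : 1 + ρ ≤ 1.68 * Real.sqrt (2 * ρ) := by
    have h : (1 + ρ) / 1.68 ≤ Real.sqrt (2 * ρ) := by
      refine Real.le_sqrt_of_sq_le ?_
      rw [div_pow, div_le_iff₀ (by norm_num)]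
      nlinarith [mul_nonneg (sub_nonneg.2 hρ1) (sub_nonneg.2 hρ2)]
    rw [div_le_iff₀ (by norm_num)] at h
    linarith
  have e4 : Real.sqrt (n * ℓ) ≤ Real.sqrt (n * L) := Real.sqrt_le_sqrt (by gcongr)
  have e5 : u / σx * S ≥ u * (1.68 * Real.sqrt (n * ℓ)) := by
    calc u / σx * S ≥ u / σx * (σx * ((2:ℝ) ^ ((3:ℝ)/4) * Real.sqrt (n * L))) := by gcongr
      _ = u * ((2:ℝ) ^ ((3:ℝ)/4) * Real.sqrt (n * L)) := by field_simp
      _ ≥ u * (1.68 * Real.sqrt (n * ℓ)) := by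
        have := two34_ge
        gcongr
  have e6 : u * (1.68 * Real.sqrt (n * ℓ)) = ℓ * (1.68 * Real.sqrt (2 * ρ)) := by
    linear_combination 1.68 * e2
  have e7 := mul_le_mul_of_nonneg_left e3 hℓ.le
  linarith

lemma block_sum (δ : ℝ) (hδ : 0 < δ) (D : ℝ) (hD : 0 < D) :
    Summable (fun k : ℕ => D * (2 * (δ / (7 * D * (((k:ℝ) + 1) * Real.log 2) ^ 2)))) ∧
    ∑' k : ℕ, D * (2 * (δ / (7 * D * (((k:ℝ) + 1) * Real.log 2) ^ 2))) ≤ δ := by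
  have hl := Real.log_two_gt_d9
  have hl0 : 0 < Real.log 2 := by linarith
  have h := hasSum_zeta_two
  rw [← hasSum_nat_add_iff' 1] at h
  simp only [Finset.sum_range_one, Nat.cast_zero, ne_eq, OfNat.ofNat_ne_zero, not_false_eq_true,
    zero_pow, div_zero, sub_zero] at h
  have h2 := h.mul_left (2 * δ / (7 * Real.log 2 ^ 2))
  have e : (fun k : ℕ => D * (2 * (δ / (7 * D * (((k:ℝ) + 1) * Real.log 2) ^ 2)))) =
      fun k : ℕ => 2 * δ / (7 * Real.log 2 ^ 2) * (1 / ((k + 1 : ℕ) : ℝ) ^ 2) := by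
    funext k; push_cast; field_simp
  rw [e]
  refine ⟨h2.summable, ?_⟩
  rw [h2.tsum_eq]
  have hpi := Real.pi_lt_d2
  have hpi0 := Real.pi_pos
  have hpi2 : Real.pi ^ 2 ≤ 9.9225 := by nlinarith
  have := log2_sq
  rw [div_mul_div_comm, div_le_iff₀ (by positivity)]
  nlinarith [mul_le_mul_of_nonneg_left hpi2 hδ.le, mul_le_mul_of_nonneg_left this hδ.le]

/-- uniform-in-time noise bound -/
lemma event2 (A : FSWLasso Ω P d K) (hd : 1 ≤ d) (δ : ℝ) (hδ : 0 < δ) (hδ1 : δ ≤ 1) :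
    P {ω | ¬ ∀ n : ℕ, 1 ≤ n → ∀ j,
      |∑ i ∈ Finset.Icc (A.M0 + 1) (A.M0 + n), A.X i ω (A.act i ω) j * A.η i ω| ≤
      A.σ * A.xmax * ((2:ℝ) ^ ((3:ℝ)/4) * Real.sqrt (n * LL d δ n))} ≤ ENNReal.ofReal δ := by
  have hd' : (0:ℝ) < d := by exact_mod_cast hd
  have hσx : 0 < A.σ * A.xmax := mul_pos A.hσ A.hxmax
  have hl := Real.log_two_gt_d9
  have hl0 : 0 < Real.log 2 := by linarith
  set q : ℕ → ℝ := fun k => δ / (7 * d * (((k:ℝ) + 1) * Real.log 2) ^ 2) with hq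
  have hq0 : ∀ k, 0 < q k := fun k => by rw [hq]; positivity
  set ℓ : ℕ → ℝ := fun k => Real.log (7 * d * (((k:ℝ) + 1) * Real.log 2) ^ 2 / δ) with hℓ
  have hex : ∀ k, Real.exp (-(ℓ k)) = q k := fun k => by
    rw [Real.exp_neg, hℓ, hq]; simp only
    rw [Real.exp_log (by positivity), inv_div]
  have hpow : ∀ k : ℕ, ℓ k = LL d δ (2 ^ k) := fun k => by
    rw [hℓ, LL]; simp only
    rw [show (2:ℝ) * 2 ^ k = 2 ^ (k+1) by rw [pow_succ]; ring, Real.log_pow]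
    push_cast; rfl
  have hp1 : ∀ k : ℕ, (1:ℝ) ≤ 2 ^ k := fun k => one_le_pow₀ (by norm_num)
  have hℓ0 : ∀ k, 0 < ℓ k := fun k => by rw [hpow]; exact LL_pos hd hδ hδ1 (hp1 k)
  set bad : ℕ → Fin d → Set Ω := fun k j => {ω | ∃ n : ℕ, 2 ^ k ≤ n ∧ n < 2 ^ (k+1) ∧
    A.σ * A.xmax * ((2:ℝ) ^ ((3:ℝ)/4) * Real.sqrt (n * LL d δ n)) <
    |∑ i ∈ Finset.Icc (A.M0 + 1) (A.M0 + n), A.X i ω (A.act i ω) j * A.η i ω|} with hbad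
  have hb : ∀ k j, P (bad k j) ≤ ENNReal.ofReal (2 * q k) := by
    intro k j
    set s := Real.sqrt (2 * ℓ k / 2 ^ k) / (A.σ * A.xmax) with hs
    refine prob_pair P _ _ _ (q k) (hq0 k).le ?_
      ((noise_line A A.M0 j s (ℓ k)).trans_eq (by rw [hex]))
      ((noise_line A A.M0 j (-s) (ℓ k)).trans_eq (by rw [hex]))
    rintro ω ⟨n, hn1, hn2, hn⟩
    have hnR : (2:ℝ) ^ k ≤ n := by exact_mod_cast hn1
    have hLn : ℓ k ≤ LL d δ n := by
      rw [hpow]; exact LL_mono hd hδ hδ1 (hp1 k) hnR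
    rcases lt_abs.1 hn with h | h
    · left
      refine ⟨n, ?_⟩
      have := block_real (ℓ k) _ _ _ n k (hℓ0 k) hLn hσx hn1 hn2 h
      rw [← hs] at this
      refine this.trans_eq ?_
      ring
    · right
      refine ⟨n, ?_⟩
      have := block_real (ℓ k) _ _ _ n k (hℓ0 k) hLn hσx hn1 hn2 h
      rw [← hs] at this
      refine this.trans_eq ?_
      ring
  have hb2 : ∀ k, P (⋃ j, bad k j) ≤ ENNReal.ofReal (d * (2 * q k)) := fun k =>
    prob_fin P _ _ (by have := hq0 k; positivity) (hb k)
  obtain ⟨hsum, hle⟩ := block_sum δ hδ d hd'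
  have hb3 := prob_nat P _ _ (fun k => by have := hq0 k; positivity) hsum hb2
  refine le_trans (measure_mono ?_) (hb3.trans (ENNReal.ofReal_le_ofReal hle))
  intro ω hω
  have hω' : ¬ ∀ n : ℕ, 1 ≤ n → ∀ j,
      |∑ i ∈ Finset.Icc (A.M0 + 1) (A.M0 + n), A.X i ω (A.act i ω) j * A.η i ω| ≤
      A.σ * A.xmax * ((2:ℝ) ^ ((3:ℝ)/4) * Real.sqrt (n * LL d δ n)) := hω
  push Not at hω'
  obtain ⟨n, hn, j, hj⟩ := hω'
  simp only [Set.mem_iUnion]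
  exact ⟨Nat.log 2 n, j, n, Nat.pow_log_le_self 2 (by omega),
    Nat.lt_pow_succ_log_self (by norm_num) n, hj⟩

/-- concentration of the optimal-arm Gram matrix -/
lemma event3 (A : FSWLasso Ω P d K) (δ : ℝ) (o N : ℕ) (ε H : ℝ) (hε : 0 < ε) (hH : 0 < H)
    (hHε : H * ε ^ 2 = 2 * (A.xmax ^ 2) ^ 2)
    (hN : 2 * (d:ℝ) ^ 2 * (H * Real.exp (-(N / H))) ≤ δ) :
    P {ω | ¬ ∀ n : ℕ, N + 1 ≤ n → ∀ a b,
      |∑ i ∈ Finset.Icc (o + 1) (o + n), optF A.βstar a b (A.X i ω) - n * optSig A a b| ≤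
      n * ε} ≤ ENNReal.ofReal δ := by
  have hx := A.hxmax
  set bad : ℕ → Fin d → Fin d → Set Ω := fun k a b => {ω |
    ((N + 1 + k : ℕ) : ℝ) * ε <
      |∑ i ∈ Finset.Icc (o + 1) (o + (N + 1 + k)), optF A.βstar a b (A.X i ω)
        - ((N + 1 + k : ℕ) : ℝ) * optSig A a b|} with hbad
  set q : ℕ → ℝ := fun k => Real.exp (-(((N + 1 + k : ℕ) : ℝ) / H)) with hq
  set s := ε / (A.xmax ^ 2) ^ 2 with hs
  have hs0 : 0 < s := by rw [hs]; positivity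
  have hb : ∀ k a b, P (bad k a b) ≤ ENNReal.ofReal (2 * q k) := by
    intro k a b
    refine prob_pair P _ _ _ (q k) (Real.exp_pos _).le ?_
      (opt_line A o a b s (((N + 1 + k : ℕ) : ℝ) / H))
      (opt_line A o a b (-s) (((N + 1 + k : ℕ) : ℝ) / H))
    intro ω hω
    have hω' : ((N + 1 + k : ℕ) : ℝ) * ε <
      |∑ i ∈ Finset.Icc (o + 1) (o + (N + 1 + k)), optF A.βstar a b (A.X i ω)
        - ((N + 1 + k : ℕ) : ℝ) * optSig A a b| := hω
    have e1 : ((N + 1 + k : ℕ) : ℝ) / H = s * (((N + 1 + k : ℕ) : ℝ) * ε) -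
        ((N + 1 + k : ℕ) : ℝ) * (s ^ 2 * (A.xmax ^ 2) ^ 2 / 2) := by
      have : H = 2 * (A.xmax ^ 2) ^ 2 / ε ^ 2 := by field_simp; linarith
      rw [this, hs]; field_simp; ring
    rcases lt_abs.1 hω' with h | h
    · left
      refine ⟨N + 1 + k, ?_⟩
      have := mul_lt_mul_of_pos_left h hs0
      rw [e1]; linarith
    · right
      refine ⟨N + 1 + k, ?_⟩
      have := mul_lt_mul_of_pos_left h hs0
      rw [e1, neg_sq]; linarith
  have hq0 : ∀ k, 0 < q k := fun k => Real.exp_pos _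
  have hb2 : ∀ k, P (⋃ a, ⋃ b, bad k a b) ≤ ENNReal.ofReal (d * (d * (2 * q k))) := fun k =>
    prob_fin P _ _ (by have := hq0 k; positivity)
      (fun a => prob_fin P _ _ (by have := hq0 k; positivity) (hb k a))
  have hqe : q = fun k : ℕ => Real.exp (-(((N:ℝ) + 1) / H)) * Real.exp (-(1/H)) ^ k := by
    funext k
    rw [hq, ← Real.exp_nat_mul, ← Real.exp_add]; push_cast; congr 1; field_simp; ring
  have hr1 : Real.exp (-(1/H)) < 1 := by
    rw [Real.exp_lt_one_iff]
    have : 0 < 1 / H := by positivity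
    linarith
  have hgeo := (hasSum_geometric_of_lt_one (Real.exp_pos (-(1/H))).le hr1).mul_left
    (Real.exp (-(((N:ℝ) + 1) / H)))
  rw [← hqe] at hgeo
  have hsum := ((hgeo.mul_left 2).mul_left (d:ℝ)).mul_left (d:ℝ)
  have hb3 := prob_nat P _ _ (fun k => by have := hq0 k; positivity) hsum.summable hb2
  refine le_trans (measure_mono ?_) (hb3.trans (ENNReal.ofReal_le_ofReal ?_))
  · intro ω hω
    have hω' : ¬ ∀ n : ℕ, N + 1 ≤ n → ∀ a b,
      |∑ i ∈ Finset.Icc (o + 1) (o + n), optF A.βstar a b (A.X i ω) - n * optSig A a b| ≤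
      n * ε := hω
    push Not at hω'
    obtain ⟨n, hn, a, b, hj⟩ := hω'
    simp only [Set.mem_iUnion]
    obtain ⟨k, rfl⟩ := Nat.exists_eq_add_of_le hn
    exact ⟨k, a, b, hj⟩
  · rw [hsum.tsum_eq]
    refine le_trans ?_ hN
    have e : Real.exp (-(((N:ℝ) + 1) / H)) * (1 - Real.exp (-(1/H)))⁻¹ ≤
        H * Real.exp (-(N / H)) := by
      rw [← div_eq_mul_inv, div_le_iff₀ (by linarith)]
      have h1 : Real.exp (-(((N:ℝ) + 1) / H)) = Real.exp (-(N/H)) * Real.exp (-(1/H)) := by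
        rw [← Real.exp_add]; congr 1; ring
      rw [h1]
      have h2 : Real.exp (-(1/H)) ≤ H * (1 - Real.exp (-(1/H))) := by
        have h3 := Real.add_one_le_exp (1/H)
        have h4 : Real.exp (-(1/H)) * Real.exp (1/H) = 1 := by rw [← Real.exp_add]; simp
        have h5 := Real.exp_pos (-(1/H))
        have h6 : Real.exp (-(1/H)) * (1/H + 1) ≤ 1 := by
          calc _ ≤ Real.exp (-(1/H)) * Real.exp (1/H) := mul_le_mul_of_nonneg_left h3 h5.le
            _ = 1 := h4
        have h7 : H * (Real.exp (-(1/H)) * (1/H + 1)) ≤ H * 1 := by gcongr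
        have h8 : H * (Real.exp (-(1/H)) * (1/H + 1)) = Real.exp (-(1/H)) + H * Real.exp (-(1/H)) := by
          field_simp
        linarith
      have := Real.exp_pos (-(N/H))
      nlinarith
    calc _ = 2 * (d:ℝ) ^ 2 * (Real.exp (-(((N:ℝ) + 1) / H)) * (1 - Real.exp (-(1/H)))⁻¹) := by ring
      _ ≤ _ := by gcongr

/-- number of small-gap rounds -/
lemma event4 (A : FSWLasso Ω P d K) (δ : ℝ) (hδ : 0 < δ) (o : ℕ) (h : ℝ) (hh : 0 < h) :
    P {ω | ¬ ∀ n : ℕ, ∑ i ∈ Finset.Icc (o + 1) (o + n),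
      (A.X i ⁻¹' Gset K A.βstar h).indicator (1 : Ω → ℝ) ω ≤
      4 * Real.log (1/δ) + n * ((h / A.Δstar) ^ A.α * (116/100))} ≤ ENNReal.ofReal δ := by
  have := bern_line A o h hh (Real.log (1/δ))
  rw [Real.exp_neg, Real.exp_log (by positivity), one_div, inv_inv] at this
  refine le_trans (measure_mono ?_) this
  intro ω hω
  have hω' : ¬ ∀ n : ℕ, ∑ i ∈ Finset.Icc (o + 1) (o + n),
      (A.X i ⁻¹' Gset K A.βstar h).indicator (1 : Ω → ℝ) ω ≤
      4 * Real.log (1/δ) + n * ((h / A.Δstar) ^ A.α * (116/100)) := hω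
  push Not at hω'
  obtain ⟨n, hn⟩ := hω'
  refine ⟨n, ?_⟩
  rw [one_div] at hn
  linarith
end ev


lemma l1_nonneg {d : ℕ} (v : Fin d → ℝ) : 0 ≤ l1 v := Finset.sum_nonneg fun _ _ => abs_nonneg _

lemma l1_split {d : ℕ} (S : Finset (Fin d)) (v : Fin d → ℝ) :
    l1 v = l1 (restr S v) + l1 (restr Sᶜ v) := by
  unfold l1 restr
  rw [← Finset.sum_add_distrib]
  refine Finset.sum_congr rfl fun j _ => ?_
  by_cases h : j ∈ S <;> simp [h]

lemma l1_eq_zero {d : ℕ} {v : Fin d → ℝ} (h : l1 v = 0) : v = 0 := by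
  unfold l1 at h
  rw [Finset.sum_eq_zero_iff_of_nonneg (fun _ _ => abs_nonneg _)] at h
  funext j
  simpa using h j (Finset.mem_univ j)

lemma l1_zero {d : ℕ} : l1 (0 : Fin d → ℝ) = 0 := by simp [l1]

lemma abs_dot_le {d : ℕ} {c : ℝ} {x v : Fin d → ℝ} (hx : ∀ j, |x j| ≤ c) :
    |x ⬝ᵥ v| ≤ c * l1 v := by
  unfold l1 dotProduct
  rw [Finset.mul_sum]
  refine (Finset.abs_sum_le_sum_abs _ _).trans (Finset.sum_le_sum fun j _ => ?_)
  rw [abs_mul]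
  exact mul_le_mul_of_nonneg_right (hx j) (abs_nonneg _)

lemma quad_eq {d : ℕ} (M : Matrix (Fin d) (Fin d) ℝ) (v : Fin d → ℝ) :
    v ⬝ᵥ (M *ᵥ v) = ∑ a, ∑ b, v a * v b * M a b := by
  simp only [dotProduct, mulVec, Finset.mul_sum]
  refine Finset.sum_congr rfl fun a _ => Finset.sum_congr rfl fun b _ => ?_
  ring

lemma dot_sq {d : ℕ} (x v : Fin d → ℝ) :
    (x ⬝ᵥ v) ^ 2 = ∑ a, ∑ b, v a * v b * (x a * x b) := by
  rw [sq, dotProduct, Finset.sum_mul_sum]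
  refine Finset.sum_congr rfl fun a _ => Finset.sum_congr rfl fun b _ => ?_
  ring

lemma compat_use {d : ℕ} {M : Matrix (Fin d) (Fin d) ℝ} {S : Finset (Fin d)} {c : ℝ}
    (hc : 0 < c) (h : c ≤ compat M S) {v : Fin d → ℝ}
    (hv : l1 (restr Sᶜ v) ≤ 3 * l1 (restr S v)) :
    c * l1 (restr S v) ^ 2 ≤ S.card * (v ⬝ᵥ (M *ᵥ v)) := by
  by_cases h0 : restr S v = 0
  · have e : l1 (restr S v) = 0 := by rw [h0, l1_zero]
    have e2 : l1 v = 0 := by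
      rw [l1_split S v, e]
      rw [e] at hv
      have := l1_nonneg (restr Sᶜ v)
      linarith
    rw [e, l1_eq_zero e2]; simp
  · have hpos : 0 < l1 (restr S v) :=
      lt_of_le_of_ne (l1_nonneg _) (fun e => h0 (l1_eq_zero e.symm))
    rw [← le_div_iff₀ (by positivity)]
    refine h.trans ?_
    unfold compat
    refine csInf_le ?_ ⟨v, hv, h0, rfl⟩
    by_contra hb
    have := Real.sInf_of_not_bddBelow hb
    unfold compat at h
    rw [this] at h
    linarith

lemma lasso_basic {d : ℕ} (I J : Finset ℕ) (x : ℕ → Fin d → ℝ) (η : ℕ → ℝ)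
    (β b : Fin d → ℝ) (w lam : ℝ) (hl : 0 < lam) (S : Finset (Fin d))
    (hS : ∀ j, j ∉ S → β j = 0)
    (hmin : w * ∑ i ∈ I, (x i ⬝ᵥ b - (x i ⬝ᵥ β + η i)) ^ 2 +
        ∑ i ∈ J, (x i ⬝ᵥ b - (x i ⬝ᵥ β + η i)) ^ 2 + lam * l1 b ≤
      w * ∑ i ∈ I, (x i ⬝ᵥ β - (x i ⬝ᵥ β + η i)) ^ 2 +
        ∑ i ∈ J, (x i ⬝ᵥ β - (x i ⬝ᵥ β + η i)) ^ 2 + lam * l1 β)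
    (hn : ∀ j, |w * ∑ i ∈ I, x i j * η i + ∑ i ∈ J, x i j * η i| ≤ lam / 4) :
    (w * ∑ i ∈ I, (x i ⬝ᵥ (β - b)) ^ 2 + ∑ i ∈ J, (x i ⬝ᵥ (β - b)) ^ 2) +
      lam / 2 * l1 (β - b) ≤ 2 * lam * l1 (restr S (β - b)) := by
  set v := β - b with hv
  have key : ∀ T : Finset ℕ, ∑ i ∈ T, (x i ⬝ᵥ b - (x i ⬝ᵥ β + η i)) ^ 2 =
      ∑ i ∈ T, (x i ⬝ᵥ v) ^ 2 + 2 * ∑ i ∈ T, η i * (x i ⬝ᵥ v) + ∑ i ∈ T, η i ^ 2 := by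
    intro T
    rw [Finset.mul_sum, ← Finset.sum_add_distrib, ← Finset.sum_add_distrib]
    refine Finset.sum_congr rfl fun i _ => ?_
    rw [hv, dotProduct_sub]; ring
  have key2 : ∀ T : Finset ℕ, ∑ i ∈ T, (x i ⬝ᵥ β - (x i ⬝ᵥ β + η i)) ^ 2 = ∑ i ∈ T, η i ^ 2 := by
    intro T
    refine Finset.sum_congr rfl fun i _ => ?_
    ring
  rw [key, key, key2, key2] at hmin
  have key3 : ∀ T : Finset ℕ, ∑ i ∈ T, η i * (x i ⬝ᵥ v) = ∑ j, v j * ∑ i ∈ T, x i j * η i := by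
    intro T
    simp only [dotProduct, Finset.mul_sum]
    rw [Finset.sum_comm]
    refine Finset.sum_congr rfl fun i _ => Finset.sum_congr rfl fun b _ => ?_
    ring
  have key4 : -(lam / 4 * l1 v) ≤ w * ∑ i ∈ I, η i * (x i ⬝ᵥ v) + ∑ i ∈ J, η i * (x i ⬝ᵥ v) := by
    rw [key3, key3, Finset.mul_sum, ← Finset.sum_add_distrib]
    have : |∑ j, (w * (v j * ∑ i ∈ I, x i j * η i) + v j * ∑ i ∈ J, x i j * η i)| ≤
        lam / 4 * l1 v := by
      unfold l1
      rw [Finset.mul_sum]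
      refine (Finset.abs_sum_le_sum_abs _ _).trans (Finset.sum_le_sum fun j _ => ?_)
      have e : w * (v j * ∑ i ∈ I, x i j * η i) + v j * ∑ i ∈ J, x i j * η i =
        (w * ∑ i ∈ I, x i j * η i + ∑ i ∈ J, x i j * η i) * v j := by ring
      rw [e, abs_mul]
      exact mul_le_mul_of_nonneg_right (hn j) (abs_nonneg _)
    exact (abs_le.1 this).1
  have key5 : l1 β - l1 b ≤ l1 (restr S v) - l1 (restr Sᶜ v) := by
    unfold l1
    rw [← Finset.sum_sub_distrib, ← Finset.sum_sub_distrib]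
    refine Finset.sum_le_sum fun j _ => ?_
    by_cases h : j ∈ S
    · simp only [restr, h, if_true, Finset.mem_compl, not_true, if_false, abs_zero, sub_zero, hv]
      exact abs_sub_abs_le_abs_sub _ _
    · simp [restr, h, hv, hS j h]
  have key6 := l1_split S v
  nlinarith

lemma quad_max {κ s lam y l Q : ℝ} (hκ : 0 < κ) (hs : 0 < s) (hl : 0 < lam)
    (h : Q + lam / 2 * l ≤ 2 * lam * y) (hQ : κ * y ^ 2 ≤ s * Q) : l ≤ 2 * lam * s / κ := by
  rw [le_div_iff₀ hκ]
  have h1 : κ * y ^ 2 + s * (lam / 2 * l) ≤ s * (2 * lam * y) := by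
    have := mul_le_mul_of_nonneg_left h hs.le
    linarith
  have h2 : (s * lam) * (l * κ) ≤ (s * lam) * (2 * lam * s) := by
    nlinarith [sq_nonneg (κ * y - s * lam), mul_le_mul_of_nonneg_left h1 hκ.le]
  exact le_of_mul_le_mul_left h2 (by positivity)

lemma C2_lemma {a C n : ℝ} (ha : 1 ≤ a) (hC : 2 ≤ C)
    (hn : C * a + 2 * C * Real.log (a + Real.log (4 * C ^ 2)) ≤ n) :
    C * (2 * Real.log (Real.log (2 * n)) + a) ≤ n := by
  have hC0 : 0 < C := by linarith
  have hl4 : Real.log 4 = 2 * Real.log 2 := by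
    rw [show (4:ℝ) = 2 ^ 2 by norm_num, Real.log_pow]; norm_num
  have hl2 := Real.log_two_lt_d9
  have hl2' := Real.log_two_gt_d9
  have hl4C : Real.log (4 * C ^ 2) = 2 * Real.log 2 + 2 * Real.log C := by
    rw [Real.log_mul (by norm_num) (by positivity), hl4, Real.log_pow]; norm_num
  have hlC := Real.log_le_sub_one_of_pos hC0
  have hlC2 : Real.log 2 ≤ Real.log C := Real.log_le_log (by norm_num) hC
  set B := a + Real.log (4 * C ^ 2) with hB
  have hB2 : 2 ≤ B := by rw [hB, hl4C]; linarith
  have hlB0 : 0 ≤ Real.log B := Real.log_nonneg (by linarith)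
  have hlB : Real.log B ≤ B / 2 - 0.3 := by
    have h1 := Real.log_le_sub_one_of_pos (show 0 < B / 2 by linarith)
    rw [Real.log_div (by linarith) (by norm_num)] at h1
    linarith
  set n0 := C * a + 2 * C * Real.log B with hn0
  have hn0C : C ≤ n0 := by nlinarith [mul_nonneg hC0.le hlB0]
  have hn0p : 0 < n0 := by linarith
  have hexpB : Real.exp B = 4 * C ^ 2 * Real.exp a := by
    rw [hB, Real.exp_add, Real.exp_log (by positivity)]; ring
  have h2n0 : 2 * n0 ≤ Real.exp B := by
    have he := Real.add_one_le_exp a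
    have h1 : a + 2 * Real.log B ≤ 2 * C * Real.exp a := by
      have : 2 * C * (a + 1) ≤ 2 * C * Real.exp a := by gcongr
      nlinarith
    rw [hexpB]
    calc 2 * n0 = 2 * C * (a + 2 * Real.log B) := by rw [hn0]; ring
      _ ≤ 2 * C * (2 * C * Real.exp a) := by gcongr
      _ = _ := by ring
  have hy : Real.log (2 * n) ≤ B + (n - n0) / n0 := by
    have e : 2 * n = (2 * n0) * (n / n0) := by field_simp
    have hnn : 0 < n / n0 := div_pos (by linarith) hn0p
    rw [e, Real.log_mul (by positivity) hnn.ne']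
    have h1 : Real.log (2 * n0) ≤ B := by
      rw [← Real.log_exp B]; exact Real.log_le_log (by positivity) h2n0
    have h2 := Real.log_le_sub_one_of_pos hnn
    have h3 : n / n0 - 1 = (n - n0) / n0 := by field_simp
    linarith
  have hypos : 0 < Real.log (2 * n) := Real.log_pos (by linarith)
  have hly : Real.log (Real.log (2 * n)) ≤ Real.log B + (n - n0) / (n0 * B) := by
    have e : Real.log (2 * n) = B * (Real.log (2 * n) / B) := by field_simp
    have hnn : 0 < Real.log (2 * n) / B := div_pos hypos (by linarith)
    rw [e, Real.log_mul (by linarith) hnn.ne']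
    have h2 := Real.log_le_sub_one_of_pos hnn
    have h3 : Real.log (2 * n) / B ≤ (B + (n - n0) / n0) / B := by gcongr
    have h4 : (B + (n - n0) / n0) / B - 1 = (n - n0) / (n0 * B) := by
      have : B ≠ 0 := by linarith
      field_simp
      ring
    linarith
  have h5 : 2 * C * ((n - n0) / (n0 * B)) ≤ n - n0 := by
    rw [mul_div_assoc', div_le_iff₀ (by positivity), mul_comm]
    refine mul_le_mul_of_nonneg_left ?_ (by linarith)
    nlinarith
  have h6 : 2 * C * Real.log (Real.log (2 * n)) ≤ 2 * C * (Real.log B + (n - n0) / (n0 * B)) := by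
    gcongr
  have h7 : C * (2 * Real.log (Real.log (2 * n)) + a) =
    2 * C * Real.log (Real.log (2 * n)) + C * a := by ring
  rw [h7]
  have h8 : 2 * C * (Real.log B + (n - n0) / (n0 * B)) =
    2 * C * Real.log B + 2 * C * ((n - n0) / (n0 * B)) := by ring
  linarith



section det2
variable [mΩ : MeasurableSpace Ω] {P : Measure Ω} {d K : ℕ}

lemma d_pos (A : FSWLasso Ω P d K) : 1 ≤ d := by
  obtain ⟨j, _⟩ := A.suppNe
  have := j.2
  omega

lemma card_ge_one (A : FSWLasso Ω P d K) : (1:ℝ) ≤ (supp A.βstar).card := by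
  exact_mod_cast Finset.card_pos.2 A.suppNe

lemma optSig_compat (A : FSWLasso Ω P d K) : A.φstar ^ 2 ≤ compat (optSig A) (supp A.βstar) := by
  rw [← gram_eq A 1 le_rfl]
  exact A.compatOpt 1 le_rfl

lemma q_ge (A : FSWLasso Ω P d K) : A.φstar ^ 2 ≤ A.xmax ^ 2 * (supp A.βstar).card := by
  have := A.probMeas
  obtain ⟨j, hj⟩ := A.suppNe
  have hφ := A.hφstar
  have h1 : ∀ i, restr (supp A.βstar) (Pi.single j (1:ℝ)) i = (Pi.single j (1:ℝ) : Fin d → ℝ) i := by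
    intro i
    unfold restr
    by_cases h : i = j
    · subst h; rw [if_pos hj]
    · simp [h]
  have h2 : l1 (restr (supp A.βstar) (Pi.single j (1:ℝ))) = 1 := by
    rw [funext h1]
    unfold l1
    rw [Finset.sum_eq_single j]
    · simp
    · intro b _ hb; simp [hb]
    · simp
  have h4 : l1 (Pi.single j (1:ℝ) : Fin d → ℝ) = 1 := by rw [← funext h1, h2]
  have h3 : l1 (restr (supp A.βstar)ᶜ (Pi.single j (1:ℝ))) = 0 := by
    have := l1_split (supp A.βstar) (Pi.single j (1:ℝ))
    linarith
  have h5 := compat_use (v := Pi.single j (1:ℝ)) (by positivity) (optSig_compat A)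
    (by rw [h2, h3]; norm_num)
  rw [h2] at h5
  have h6 : (Pi.single j (1:ℝ) : Fin d → ℝ) ⬝ᵥ (optSig A *ᵥ Pi.single j (1:ℝ)) = optSig A j j := by
    simp
  rw [h6, ← gram_eq A 1 le_rfl, gram, Matrix.of_apply] at h5
  have h7 : ∫ ω, A.X 1 ω (A.astar 1 ω) j * A.X 1 ω (A.astar 1 ω) j ∂P ≤ A.xmax ^ 2 := by
    have h8 := norm_integral_le_of_norm_le_const (μ := P)
      (f := fun ω => A.X 1 ω (A.astar 1 ω) j * A.X 1 ω (A.astar 1 ω) j) (C := A.xmax ^ 2) (by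
        filter_upwards [A.bddX 1 le_rfl] with ω hω
        have := hω (A.astar 1 ω) j
        rw [Real.norm_eq_abs, abs_mul, sq]
        exact mul_le_mul this this (abs_nonneg _) A.hxmax.le)
    simp only [probReal_univ, mul_one] at h8
    exact (Real.le_norm_self _).trans h8
  have := card_ge_one A
  calc A.φstar ^ 2 = A.φstar ^ 2 * 1 ^ 2 := by ring
    _ ≤ _ := h5
    _ ≤ (supp A.βstar).card * A.xmax ^ 2 := by gcongr
    _ = _ := by ring

lemma Vhat_quad (A : FSWLasso Ω P d K) (n : ℕ) (ω : Ω) (v : Fin d → ℝ) :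
    v ⬝ᵥ (Vhat A n ω *ᵥ v) = A.w * ∑ i ∈ Finset.Icc 1 A.M0, (A.X i ω (A.act i ω) ⬝ᵥ v) ^ 2 +
      ∑ i ∈ Finset.Icc (A.M0 + 1) (A.M0 + n), (A.X i ω (A.act i ω) ⬝ᵥ v) ^ 2 := by
  have key : ∀ T : Finset ℕ, ∑ i ∈ T, (A.X i ω (A.act i ω) ⬝ᵥ v) ^ 2 =
      ∑ a, ∑ b, v a * v b * ∑ i ∈ T, A.X i ω (A.act i ω) a * A.X i ω (A.act i ω) b := by
    intro T
    simp only [dot_sq, Finset.mul_sum]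
    rw [Finset.sum_comm]
    refine Finset.sum_congr rfl fun a _ => ?_
    rw [Finset.sum_comm]
  rw [key, key, quad_eq, Finset.mul_sum, ← Finset.sum_add_distrib]
  refine Finset.sum_congr rfl fun a _ => ?_
  rw [Finset.mul_sum, ← Finset.sum_add_distrib]
  refine Finset.sum_congr rfl fun b _ => ?_
  simp only [Vhat, Matrix.of_apply]
  ring

lemma Icc_split (f : ℕ → ℝ) (o m n : ℕ) (h : m ≤ n) :
    ∑ i ∈ Finset.Icc (o + 1) (o + n), f i = ∑ i ∈ Finset.Icc (o + 1) (o + m), f i +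
      ∑ i ∈ Finset.Icc (o + m + 1) (o + m + (n - m)), f i := by
  rw [← sum_range_Icc, ← sum_range_Icc, ← sum_range_Icc]
  obtain ⟨k, rfl⟩ := Nat.exists_eq_add_of_le h
  rw [Finset.sum_range_add, Nat.add_sub_cancel_left]
  congr 1
  refine Finset.sum_congr rfl fun i _ => ?_
  congr 1; omega

lemma det_step (A : FSWLasso Ω P d K) (ω : Ω) (n : ℕ) (hl : 0 < A.lam (A.M0 + n))
    (hn : ∀ j, |A.w * ∑ i ∈ Finset.Icc 1 A.M0, A.X i ω (A.act i ω) j * A.η i ω +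
      ∑ i ∈ Finset.Icc (A.M0 + 1) (A.M0 + n), A.X i ω (A.act i ω) j * A.η i ω|
      ≤ A.lam (A.M0 + n) / 4) (κ : ℝ) (hκ : 0 < κ)
    (hQ : ∀ v, l1 (restr (supp A.βstar)ᶜ v) ≤ 3 * l1 (restr (supp A.βstar) v) →
      κ * l1 (restr (supp A.βstar) v) ^ 2 ≤ (supp A.βstar).card * (v ⬝ᵥ (Vhat A n ω *ᵥ v))) :
    l1 (A.βstar - A.βhat (A.M0 + n) ω) ≤
      2 * A.lam (A.M0 + n) * (supp A.βstar).card / κ := by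
  have h := lasso_basic (Finset.Icc 1 A.M0) (Finset.Icc (A.M0 + 1) (A.M0 + n))
    (fun i => A.X i ω (A.act i ω)) (fun i => A.η i ω) A.βstar (A.βhat (A.M0 + n) ω) A.w
    (A.lam (A.M0 + n)) hl (supp A.βstar) (by intro j hj; simpa [supp] using hj)
    (A.lasso (A.M0 + n) (by omega) ω A.βstar) hn
  rw [← Vhat_quad] at h
  set v := A.βstar - A.βhat (A.M0 + n) ω
  have hs := card_ge_one A
  have hQ0 : 0 ≤ v ⬝ᵥ (Vhat A n ω *ᵥ v) := by
    rw [Vhat_quad]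
    have := A.hw
    positivity
  have hcone : l1 (restr (supp A.βstar)ᶜ v) ≤ 3 * l1 (restr (supp A.βstar) v) := by
    have h1 := l1_split (supp A.βstar) v
    have h2 : A.lam (A.M0 + n) * l1 (restr (supp A.βstar)ᶜ v) ≤
      A.lam (A.M0 + n) * (3 * l1 (restr (supp A.βstar) v)) := by
      rw [h1] at h; nlinarith
    exact le_of_mul_le_mul_left h2 hl
  exact quad_max hκ (by linarith) hl h (hQ v hcone)

lemma lower (A : FSWLasso Ω P d K) (ω : Ω) (o n : ℕ) (ε : ℝ)
    (hb : ∀ i, 1 ≤ i → ∀ k j, |A.X i ω k j| ≤ A.xmax)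
    (ho : ∀ i, 1 ≤ i → ∀ a b, optF A.βstar a b (A.X i ω) =
      A.X i ω (A.astar i ω) a * A.X i ω (A.astar i ω) b)
    (hg : ∀ a b, |∑ i ∈ Finset.Icc (o + 1) (o + n), optF A.βstar a b (A.X i ω) -
      n * optSig A a b| ≤ n * ε) (v : Fin d → ℝ)
    (hv : l1 (restr (supp A.βstar)ᶜ v) ≤ 3 * l1 (restr (supp A.βstar) v)) :
    l1 (restr (supp A.βstar) v) ^ 2 * (n * A.φstar ^ 2 - 16 * (supp A.βstar).card * (n * ε) -
      16 * A.xmax ^ 2 * (supp A.βstar).card *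
        ∑ i ∈ Finset.Icc (o + 1) (o + n), if A.act i ω ≠ A.astar i ω then (1:ℝ) else 0) ≤
    (supp A.βstar).card * ∑ i ∈ Finset.Icc (o + 1) (o + n), (A.X i ω (A.act i ω) ⬝ᵥ v) ^ 2 := by
  set s : ℝ := ((supp A.βstar).card : ℝ) with hs
  set y := l1 (restr (supp A.βstar) v) with hy
  have hs1 := card_ge_one A
  have hy0 : 0 ≤ y := l1_nonneg _
  have hl4 : l1 v ≤ 4 * y := by rw [l1_split (supp A.βstar) v]; linarith
  have hl0 := l1_nonneg v
  have hl16 : l1 v ^ 2 ≤ 16 * y ^ 2 := by nlinarith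
  have hx := A.hxmax
  have h1 : ∀ i ∈ Finset.Icc (o + 1) (o + n),
      (∑ a, ∑ b, v a * v b * optF A.βstar a b (A.X i ω)) -
        16 * A.xmax ^ 2 * y ^ 2 * (if A.act i ω ≠ A.astar i ω then (1:ℝ) else 0) ≤
      (A.X i ω (A.act i ω) ⬝ᵥ v) ^ 2 := by
    intro i hi
    have hi1 : 1 ≤ i := by rw [Finset.mem_Icc] at hi; omega
    have e : ∑ a, ∑ b, v a * v b * optF A.βstar a b (A.X i ω) =
        (A.X i ω (A.astar i ω) ⬝ᵥ v) ^ 2 := by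
      rw [dot_sq]; simp only [ho i hi1]
    rw [e]
    by_cases h : A.act i ω = A.astar i ω
    · simp [h]
    · rw [if_pos h]
      have h2 := abs_dot_le (v := v) (hb i hi1 (A.astar i ω))
      have h3 : (A.X i ω (A.astar i ω) ⬝ᵥ v) ^ 2 ≤ (A.xmax * l1 v) ^ 2 := by
        rw [← sq_abs]; gcongr
      have h4 : (A.xmax * l1 v) ^ 2 ≤ A.xmax ^ 2 * (16 * y ^ 2) := by rw [mul_pow]; gcongr
      nlinarith [sq_nonneg (A.X i ω (A.act i ω) ⬝ᵥ v)]
  have h2 := Finset.sum_le_sum h1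
  rw [Finset.sum_sub_distrib, ← Finset.mul_sum] at h2
  have h3 : ∑ i ∈ Finset.Icc (o + 1) (o + n), ∑ a, ∑ b, v a * v b * optF A.βstar a b (A.X i ω) =
      ∑ a, ∑ b, v a * v b * ∑ i ∈ Finset.Icc (o + 1) (o + n), optF A.βstar a b (A.X i ω) := by
    rw [Finset.sum_comm]
    refine Finset.sum_congr rfl fun a _ => ?_
    rw [Finset.sum_comm]
    simp only [Finset.mul_sum]
  have h4 : n * (v ⬝ᵥ (optSig A *ᵥ v)) - (n * ε) * l1 v ^ 2 ≤
      ∑ a, ∑ b, v a * v b * ∑ i ∈ Finset.Icc (o + 1) (o + n), optF A.βstar a b (A.X i ω) := by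
    have e1 : l1 v ^ 2 = ∑ a, ∑ b, |v a| * |v b| := by rw [l1, sq, Finset.sum_mul_sum]
    rw [quad_eq, e1, Finset.mul_sum, Finset.mul_sum, ← Finset.sum_sub_distrib]
    refine Finset.sum_le_sum fun a _ => ?_
    rw [Finset.mul_sum, Finset.mul_sum, ← Finset.sum_sub_distrib]
    refine Finset.sum_le_sum fun b _ => ?_
    have h5 : |v a * v b * (∑ i ∈ Finset.Icc (o + 1) (o + n), optF A.βstar a b (A.X i ω) -
      n * optSig A a b)| ≤ |v a| * |v b| * (n * ε) := by
      rw [abs_mul, abs_mul]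
      exact mul_le_mul_of_nonneg_left (hg a b) (by positivity)
    have h6 := (abs_le.1 h5).1
    linarith
  have hφ := A.hφstar
  have h5 := compat_use (by positivity) (optSig_compat A) hv
  have hnε : 0 ≤ n * ε := by
    have j : Fin d := ⟨0, d_pos A⟩
    exact (abs_nonneg _).trans (hg j j)
  have h6 : (n:ℝ) * (A.φstar ^ 2 * y ^ 2) ≤ n * (s * (v ⬝ᵥ (optSig A *ᵥ v))) := by gcongr
  have h7 : s * ((n * ε) * l1 v ^ 2) ≤ s * ((n * ε) * (16 * y ^ 2)) := by gcongr
  rw [h3] at h2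
  have h8 : s * (n * (v ⬝ᵥ (optSig A *ᵥ v)) - (n * ε) * l1 v ^ 2 -
    16 * A.xmax ^ 2 * y ^ 2 *
      ∑ i ∈ Finset.Icc (o + 1) (o + n), if A.act i ω ≠ A.astar i ω then (1:ℝ) else 0) ≤
    s * ∑ i ∈ Finset.Icc (o + 1) (o + n), (A.X i ω (A.act i ω) ⬝ᵥ v) ^ 2 := by
    refine mul_le_mul_of_nonneg_left ?_ (by linarith)
    linarith
  linarith

lemma bad_mem (A : FSWLasso Ω P d K) (ω : Ω) (i : ℕ) (hi : A.M0 < i) (R : ℝ)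
    (hb : ∀ k j, |A.X i ω k j| ≤ A.xmax) (hne : A.act i ω ≠ A.astar i ω)
    (hR : l1 (A.βstar - A.βhat (i - 1) ω) ≤ R) :
    A.X i ω ∈ Gset K A.βstar (2 * A.xmax * R) := by
  refine ⟨A.astar i ω, A.act i ω, hne, fun l => A.optAstar i ω l, ?_⟩
  have h1 := abs_le.1 (abs_dot_le (v := A.βstar - A.βhat (i - 1) ω) (hb (A.astar i ω)))
  have h2 := abs_le.1 (abs_dot_le (v := A.βstar - A.βhat (i - 1) ω) (hb (A.act i ω)))
  have h3 := A.greedy i hi ω (A.astar i ω)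
  rw [dotProduct_sub] at h1 h2
  have h4 := mul_le_mul_of_nonneg_left hR A.hxmax.le
  linarith [h1.2, h2.1]

end det2


section lamsec
variable [mΩ : MeasurableSpace Ω] {P : Measure Ω} {d K : ℕ}

def lamF (A : FSWLasso Ω P d K) (δ : ℝ) (n : ℕ) : ℝ :=
  4 * A.σ * A.xmax * (A.w * Real.sqrt (2 * A.M0 * Real.log (2 * d / δ)) +
    (2 : ℝ) ^ ((3 : ℝ) / 4) * Real.sqrt (n * LL d δ n))

lemma lam_eq (A : FSWLasso Ω P d K) (δ : ℝ)
    (hlam : ∀ t : ℕ, A.M0 < t → A.lam t =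
      4 * A.σ * A.xmax * (Real.sqrt (2 * A.w ^ 2 * A.M0 * Real.log (2 * d / δ)) +
        (2 : ℝ) ^ ((3 : ℝ) / 4) * Real.sqrt (((t : ℝ) - A.M0) *
          Real.log (7 * d * (Real.log (2 * ((t : ℝ) - A.M0))) ^ 2 / δ))))
    (n : ℕ) (hn : 1 ≤ n) : A.lam (A.M0 + n) = lamF A δ n := by
  rw [hlam _ (by omega), lamF]
  have e : ((A.M0 + n : ℕ) : ℝ) - A.M0 = n := by push_cast; ring
  have e2 : 2 * A.w ^ 2 * A.M0 * Real.log (2 * d / δ) =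
    A.w ^ 2 * (2 * A.M0 * Real.log (2 * d / δ)) := by ring
  rw [e, e2, Real.sqrt_mul (by positivity), Real.sqrt_sq A.hw, LL]

lemma lamF_pos (A : FSWLasso Ω P d K) {δ : ℝ} (hδ : 0 < δ) (hδ1 : δ ≤ 1) {n : ℕ} (hn : 1 ≤ n) :
    0 < lamF A δ n := by
  have hn' : (1:ℝ) ≤ n := by exact_mod_cast hn
  have := LL_pos (d_pos A) hδ hδ1 hn'
  have := A.hσ
  have := A.hxmax
  have := A.hw
  unfold lamF
  positivity

lemma lamF_mono (A : FSWLasso Ω P d K) {δ : ℝ} (hδ : 0 < δ) (hδ1 : δ ≤ 1) {m n : ℕ} (hm : 1 ≤ m)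
    (hmn : m ≤ n) : lamF A δ m ≤ lamF A δ n := by
  have hm' : (1:ℝ) ≤ m := by exact_mod_cast hm
  have hmn' : (m:ℝ) ≤ n := by exact_mod_cast hmn
  have h1 := LL_pos (d_pos A) hδ hδ1 hm'
  have h2 : LL d δ m ≤ LL d δ n := LL_mono (d_pos A) hδ hδ1 hm' hmn'
  have := A.hσ
  have := A.hxmax
  have := A.hw
  unfold lamF
  gcongr

lemma lamF_le (A : FSWLasso Ω P d K) {δ : ℝ} (hδ : 0 < δ) (hδ1 : δ ≤ 1) {n : ℕ} (hn : 1 ≤ n)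
    (hw : A.w ^ 2 * A.M0 ≤ n) :
    lamF A δ n ≤ 12.5 * A.σ * A.xmax * Real.sqrt (n * LL d δ n) := by
  have hn' : (1:ℝ) ≤ n := by exact_mod_cast hn
  have h1 := LL_pos (d_pos A) hδ hδ1 hn'
  have h2 := LL_ge (d_pos A) hδ hδ1 hn'
  have h3 := log_two_d_pos (d_pos A) hδ hδ1
  have hσ := A.hσ
  have hx := A.hxmax
  have h4 : A.w * Real.sqrt (2 * A.M0 * Real.log (2 * d / δ)) ≤
      1.4143 * Real.sqrt (n * LL d δ n) := by
    have e : A.w * Real.sqrt (2 * A.M0 * Real.log (2 * d / δ)) =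
        Real.sqrt 2 * Real.sqrt (A.w ^ 2 * A.M0 * Real.log (2 * d / δ)) := by
      rw [← Real.sqrt_sq A.hw, ← Real.sqrt_mul (by positivity), ← Real.sqrt_mul (by positivity),
        Real.sqrt_sq A.hw]
      congr 1; ring
    rw [e]
    have h5 : Real.sqrt 2 ≤ 1.4143 := by
      rw [Real.sqrt_le_left (by norm_num)]; norm_num
    gcongr
  have h6 := two34_le
  have h7 : (2 : ℝ) ^ ((3 : ℝ) / 4) * Real.sqrt (n * LL d δ n) ≤
      1.682 * Real.sqrt (n * LL d δ n) := by gcongr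
  unfold lamF
  have h8 := Real.sqrt_nonneg (n * LL d δ n)
  calc _ ≤ 4 * A.σ * A.xmax * (1.4143 * Real.sqrt (n * LL d δ n) +
      1.682 * Real.sqrt (n * LL d δ n)) := by gcongr
    _ = (12.3852 * Real.sqrt (n * LL d δ n)) * (A.σ * A.xmax) := by ring
    _ ≤ (12.5 * Real.sqrt (n * LL d δ n)) * (A.σ * A.xmax) := by gcongr; norm_num
    _ = _ := by ring

lemma noise_ok (A : FSWLasso Ω P d K) (δ : ℝ) (ω : Ω)
    (h1 : ∀ j, |∑ i ∈ Finset.Icc 1 A.M0, A.X i ω (A.act i ω) j * A.η i ω| ≤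
      A.σ * A.xmax * Real.sqrt (2 * A.M0 * Real.log (2 * d / δ)))
    (n : ℕ) (h2 : ∀ j, |∑ i ∈ Finset.Icc (A.M0 + 1) (A.M0 + n), A.X i ω (A.act i ω) j * A.η i ω| ≤
      A.σ * A.xmax * ((2:ℝ) ^ ((3:ℝ)/4) * Real.sqrt (n * LL d δ n))) (j : Fin d) :
    |A.w * ∑ i ∈ Finset.Icc 1 A.M0, A.X i ω (A.act i ω) j * A.η i ω +
      ∑ i ∈ Finset.Icc (A.M0 + 1) (A.M0 + n), A.X i ω (A.act i ω) j * A.η i ω|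
      ≤ lamF A δ n / 4 := by
  refine (abs_add_le _ _).trans ?_
  rw [abs_mul, abs_of_nonneg A.hw]
  have h3 := mul_le_mul_of_nonneg_left (h1 j) A.hw
  have h4 := h2 j
  unfold lamF
  linarith

lemma LL_eq {d : ℕ} (hd : 1 ≤ d) {δ : ℝ} (hδ : 0 < δ) {x : ℝ} (hx : 1 ≤ x) :
    LL d δ x = 2 * Real.log (Real.log (2 * x)) + Real.log (7 * d / δ) := by
  have hd' : (1:ℝ) ≤ d := by exact_mod_cast hd
  have h1 := log_2x_ge hx
  have h2 := Real.log_two_gt_d9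
  unfold LL
  have e : 7 * d * (Real.log (2 * x)) ^ 2 / δ = (Real.log (2 * x)) ^ 2 * (7 * d / δ) := by ring
  have h3 : (Real.log (2 * x)) ^ 2 ≠ 0 := pow_ne_zero _ (by linarith)
  rw [e, Real.log_mul h3 (by positivity), Real.log_pow]
  norm_num

/-- `a = log (7d/δ) ≥ 1.9` -/
lemma a_ge {d : ℕ} (hd : 1 ≤ d) {δ : ℝ} (hδ : 0 < δ) (hδ1 : δ ≤ 1) :
    1 ≤ Real.log (7 * d / δ) := by
  have hd' : (1:ℝ) ≤ d := by exact_mod_cast hd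
  rw [Real.le_log_iff_exp_le (by positivity), le_div_iff₀ hδ]
  have := Real.exp_one_lt_d9
  nlinarith [Real.exp_pos 1]

lemma C2_use {d : ℕ} (hd : 1 ≤ d) {δ : ℝ} (hδ : 0 < δ) (hδ1 : δ ≤ 1) {C : ℝ} (hC : 2 ≤ C) {n : ℝ}
    (h : C * Real.log (7 * d / δ) + 2 * C * Real.log (Real.log (28 * d * C ^ 2 / δ)) ≤ n) :
    1 ≤ n ∧ C * LL d δ n ≤ n := by
  have hd' : (1:ℝ) ≤ d := by exact_mod_cast hd
  have ha := a_ge hd hδ hδ1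
  have e : Real.log (28 * d * C ^ 2 / δ) = Real.log (7 * d / δ) + Real.log (4 * C ^ 2) := by
    rw [← Real.log_mul (by positivity) (by positivity)]
    congr 1; ring
  rw [e] at h
  have h4 : 0 ≤ Real.log (4 * C ^ 2) := Real.log_nonneg (by nlinarith)
  have h5 : 0 ≤ Real.log (Real.log (7 * d / δ) + Real.log (4 * C ^ 2)) :=
    Real.log_nonneg (by linarith)
  have hn : 1 ≤ n := by
    have : 0 ≤ 2 * C * Real.log (Real.log (7 * d / δ) + Real.log (4 * C ^ 2)) := by positivity
    nlinarith
  refine ⟨hn, ?_⟩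
  rw [LL_eq hd hδ hn]
  exact C2_lemma ha hC h

lemma R_bound {σ x s Δ φ G C L n : ℝ} (hσ : 0 < σ) (hx : 0 < x) (hs : 0 < s) (hΔ : 0 < Δ)
    (hφ : 0 < φ) (hG : 0 < G) (hn : 0 < n) (hC : 0 < C)
    (hCG : (400 * σ * x ^ 2 * s / (Δ * φ ^ 2)) ^ 2 * G ^ 2 ≤ C) (hL : C * L ≤ n) :
    200 * σ * x * s / φ ^ 2 * Real.sqrt (L / n) ≤ Δ / (2 * x * G) := by
  set D := 400 * σ * x ^ 2 * s / (Δ * φ ^ 2) * G with hD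
  have hD0 : 0 < D := by positivity
  have h1 : Real.sqrt (L / n) ≤ 1 / D := by
    rw [Real.sqrt_le_left (by positivity), div_pow, one_pow, div_le_div_iff₀ hn (by positivity)]
    by_cases hL0 : 0 ≤ L
    · have : D ^ 2 ≤ C := by rw [hD, mul_pow]; exact hCG
      nlinarith
    · push Not at hL0
      have : L * D ^ 2 ≤ 0 := mul_nonpos_of_nonpos_of_nonneg hL0.le (by positivity)
      linarith
  calc _ ≤ 200 * σ * x * s / φ ^ 2 * (1 / D) := by gcongr
    _ = Δ / (2 * x * G) := by rw [hD]; field_simp; norm_num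

end lamsec


section core
variable [mΩ : MeasurableSpace Ω] {P : Measure Ω} {d K : ℕ}

lemma Vhat_split (A : FSWLasso Ω P d K) (ω : Ω) (m n : ℕ) (h : m ≤ n) (v : Fin d → ℝ) :
    v ⬝ᵥ (Vhat A n ω *ᵥ v) = v ⬝ᵥ (Vhat A m ω *ᵥ v) +
      ∑ i ∈ Finset.Icc (A.M0 + m + 1) (A.M0 + m + (n - m)), (A.X i ω (A.act i ω) ⬝ᵥ v) ^ 2 := by
  rw [Vhat_quad, Vhat_quad, Icc_split _ A.M0 m n h]; ring

lemma det_main (A : FSWLasso Ω P d K) (δ : ℝ) (hδ : 0 < δ) (hδ1 : δ ≤ 1)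
    (s : ℝ) (hs : s = ((supp A.βstar).card : ℝ)) (τ1 τ2 : ℕ) (G : ℝ) (hG : 0 < G)
    (hlam : ∀ n : ℕ, 1 ≤ n → A.lam (A.M0 + n) = lamF A δ n)
    (hτ2 : 1 ≤ τ2)
    (hR : ∀ n : ℕ, τ2 ≤ n → 200 * A.σ * A.xmax * s / A.φstar ^ 2 * Real.sqrt (LL d δ n / n) ≤
      A.Δstar / (2 * A.xmax * G))
    (hτ : 2 * τ1 ≤ τ2) (hw : A.w ^ 2 * A.M0 ≤ τ2)
    (hlong : 16000 * (A.xmax ^ 2 * s) ≤ ((τ2 : ℝ) - τ1) * A.φstar ^ 2)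
    (ω : Ω)
    (hV : max (4 * A.xmax * s / A.Δstar * G * lamF A δ τ2)
        (64 * A.xmax ^ 2 * s * Real.log (1 / δ)) ≤ compat (Vhat A τ1 ω) (supp A.βstar))
    (hb : ∀ i, 1 ≤ i → ∀ k j, |A.X i ω k j| ≤ A.xmax)
    (ho : ∀ i, 1 ≤ i → ∀ a b, optF A.βstar a b (A.X i ω) =
      A.X i ω (A.astar i ω) a * A.X i ω (A.astar i ω) b)
    (h1 : ∀ j, |∑ i ∈ Finset.Icc 1 A.M0, A.X i ω (A.act i ω) j * A.η i ω| ≤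
      A.σ * A.xmax * Real.sqrt (2 * A.M0 * Real.log (2 * d / δ)))
    (h2 : ∀ n : ℕ, 1 ≤ n → ∀ j,
      |∑ i ∈ Finset.Icc (A.M0 + 1) (A.M0 + n), A.X i ω (A.act i ω) j * A.η i ω| ≤
      A.σ * A.xmax * ((2:ℝ) ^ ((3:ℝ)/4) * Real.sqrt (n * LL d δ n)))
    (h3 : ∀ n : ℕ, τ2 - τ1 + 1 ≤ n → ∀ a b,
      |∑ i ∈ Finset.Icc (A.M0 + τ1 + 1) (A.M0 + τ1 + n), optF A.βstar a b (A.X i ω) -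
      n * optSig A a b| ≤ n * (A.φstar ^ 2 / (32 * s)))
    (h4 : ∀ n : ℕ, ∑ i ∈ Finset.Icc (A.M0 + τ1 + 1) (A.M0 + τ1 + n),
      (A.X i ⁻¹' Gset K A.βstar (A.Δstar / G)).indicator (1 : Ω → ℝ) ω ≤
      4 * Real.log (1/δ) + n * (A.φstar ^ 2 / (80 * A.xmax ^ 2 * s) * (116/100))) :
    ∀ n : ℕ, τ2 + 1 ≤ n → l1 (A.βstar - A.βhat (A.M0 + n) ω) ≤
      200 * A.σ * A.xmax * s / A.φstar ^ 2 * Real.sqrt (LL d δ n / n) := by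
  have hs1 : 1 ≤ s := hs ▸ card_ge_one A
  have hs0 : 0 < s := by linarith
  have hx := A.hxmax
  have hσ := A.hσ
  have hφ := A.hφstar
  have hΔ := A.hΔstar
  set κ1 := 4 * A.xmax * s / A.Δstar * G * lamF A δ τ2 with hκ1
  have hl2 := lamF_pos A hδ hδ1 hτ2
  have hκ1p : 0 < κ1 := by positivity
  have hκ : ∀ v, l1 (restr (supp A.βstar)ᶜ v) ≤ 3 * l1 (restr (supp A.βstar) v) →
      max κ1 (64 * A.xmax ^ 2 * s * Real.log (1 / δ)) * l1 (restr (supp A.βstar) v) ^ 2 ≤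
      s * (v ⬝ᵥ (Vhat A τ1 ω *ᵥ v)) := by
    intro v hv
    rw [hs]
    rw [hs] at hV
    exact compat_use (lt_of_lt_of_le hκ1p (le_max_left _ _)) hV hv
  have hsmall : ∀ m : ℕ, 1 ≤ m → τ1 ≤ m → m ≤ τ2 →
      l1 (A.βstar - A.βhat (A.M0 + m) ω) ≤ A.Δstar / (2 * A.xmax * G) := by
    intro m hm1 hm2 hm3
    have hl := lamF_pos A hδ hδ1 hm1
    have hd := det_step A ω m (by rw [hlam m hm1]; exact hl)
      (by rw [hlam m hm1]; exact noise_ok A δ ω h1 m (h2 m hm1)) κ1 hκ1p (by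
        intro v hv
        have e1 := hκ v hv
        rw [← hs, Vhat_split A ω τ1 m hm2]
        have e2 : 0 ≤ ∑ i ∈ Finset.Icc (A.M0 + τ1 + 1) (A.M0 + τ1 + (m - τ1)),
          (A.X i ω (A.act i ω) ⬝ᵥ v) ^ 2 := Finset.sum_nonneg fun _ _ => sq_nonneg _
        have e3 : κ1 * l1 (restr (supp A.βstar) v) ^ 2 ≤
          max κ1 (64 * A.xmax ^ 2 * s * Real.log (1 / δ)) * l1 (restr (supp A.βstar) v) ^ 2 := by
          gcongr; exact le_max_left _ _
        nlinarith)
    refine hd.trans ?_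
    rw [hlam m hm1, ← hs]
    calc 2 * lamF A δ m * s / κ1 ≤ 2 * lamF A δ τ2 * s / κ1 := by
          have := lamF_mono A hδ hδ1 hm1 hm3
          gcongr
      _ = A.Δstar / (2 * A.xmax * G) := by rw [hκ1]; field_simp; norm_num
  intro n
  induction n using Nat.strong_induction_on with
  | _ n ih =>
  intro hn
  have hall : ∀ m : ℕ, 1 ≤ m → τ1 ≤ m → m < n →
      l1 (A.βstar - A.βhat (A.M0 + m) ω) ≤ A.Δstar / (2 * A.xmax * G) := by
    intro m hm1 hm2 hm3
    by_cases h : m ≤ τ2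
    · exact hsmall m hm1 hm2 h
    · exact (ih m hm3 (by omega)).trans (hR m (by omega))
  set N : ℝ := ∑ i ∈ Finset.Icc (A.M0 + τ1 + 1) (A.M0 + τ1 + (n - τ1)),
    if A.act i ω ≠ A.astar i ω then (1:ℝ) else 0 with hN
  have hNle : N ≤ 4 * Real.log (1/δ) +
      (n - τ1 : ℕ) * (A.φstar ^ 2 / (80 * A.xmax ^ 2 * s) * (116/100)) + 1 := by
    have e : N ≤ ∑ i ∈ Finset.Icc (A.M0 + τ1 + 1) (A.M0 + τ1 + (n - τ1)),
      ((A.X i ⁻¹' Gset K A.βstar (A.Δstar / G)).indicator (1 : Ω → ℝ) ω +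
        if i = A.M0 + 1 then (1:ℝ) else 0) := by
      refine Finset.sum_le_sum fun i hi => ?_
      rw [Finset.mem_Icc] at hi
      have hind : 0 ≤ (A.X i ⁻¹' Gset K A.βstar (A.Δstar / G)).indicator (1 : Ω → ℝ) ω :=
        Set.indicator_nonneg (fun _ _ => zero_le_one) _
      by_cases hne : A.act i ω ≠ A.astar i ω
      · rw [if_pos hne]
        by_cases hi1 : i = A.M0 + 1
        · rw [if_pos hi1]; linarith
        · rw [if_neg hi1]
          obtain ⟨m, hm⟩ : ∃ m, i - 1 = A.M0 + m := ⟨i - 1 - A.M0, by omega⟩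
          have hmR := hall m (by omega) (by omega) (by omega)
          rw [← hm] at hmR
          have hmem := bad_mem A ω i (by omega) _ (hb i (by omega)) hne hmR
          have e3 : 2 * A.xmax * (A.Δstar / (2 * A.xmax * G)) = A.Δstar / G := by field_simp
          rw [e3] at hmem
          rw [Set.indicator_of_mem (by exact hmem)]
          simp
      · rw [if_neg hne]
        split_ifs <;> linarith
    rw [Finset.sum_add_distrib] at e
    have e2 : ∑ i ∈ Finset.Icc (A.M0 + τ1 + 1) (A.M0 + τ1 + (n - τ1)),
        (if i = A.M0 + 1 then (1:ℝ) else 0) ≤ 1 := by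
      rw [Finset.sum_ite_eq']
      split_ifs <;> norm_num
    have e3 := h4 (n - τ1)
    linarith
  have hn1 : 1 ≤ n := by omega
  have hnp : (0:ℝ) < n := by exact_mod_cast hn1
  have hcast : ((n - τ1 : ℕ) : ℝ) = n - τ1 := by rw [Nat.cast_sub (by omega)]
  have hnτ2 : (τ2 : ℝ) + 1 ≤ n := by exact_mod_cast hn
  have hτ' : 2 * (τ1:ℝ) ≤ τ2 := by exact_mod_cast hτ
  have hl := lamF_pos A hδ hδ1 hn1
  have hd := det_step A ω n (by rw [hlam n hn1]; exact hl)
    (by rw [hlam n hn1]; exact noise_ok A δ ω h1 n (h2 n hn1)) (n * A.φstar ^ 2 / 8) (by positivity)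
    (by
      intro v hv
      have e1 := hκ v hv
      have e2 := lower A ω (A.M0 + τ1) (n - τ1) (A.φstar ^ 2 / (32 * s)) hb ho
        (h3 (n - τ1) (by omega)) v hv
      rw [← hs, ← hN] at e2
      rw [← hs, Vhat_split A ω τ1 n (by omega), mul_add]
      set y := l1 (restr (supp A.βstar) v)
      have e3 : (64 * A.xmax ^ 2 * s * Real.log (1 / δ)) * y ^ 2 ≤
        max κ1 (64 * A.xmax ^ 2 * s * Real.log (1 / δ)) * y ^ 2 := by
          gcongr; exact le_max_right _ _
      rw [hcast] at e2 hNle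
      set n' : ℝ := (n:ℝ) - τ1
      have hn'1 : (n:ℝ) ≤ 2 * n' := by simp only [n']; linarith
      have hn'2 : (τ2:ℝ) - τ1 ≤ n' := by simp only [n']; linarith
      have e5 : 16 * A.xmax ^ 2 * s * N ≤ 16 * A.xmax ^ 2 * s * (4 * Real.log (1/δ) +
        n' * (A.φstar ^ 2 / (80 * A.xmax ^ 2 * s) * (116/100)) + 1) := by gcongr
      have e6 : 16 * A.xmax ^ 2 * s * (4 * Real.log (1/δ) +
        n' * (A.φstar ^ 2 / (80 * A.xmax ^ 2 * s) * (116/100)) + 1) =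
        64 * A.xmax ^ 2 * s * Real.log (1/δ) + 0.232 * (n' * A.φstar ^ 2) +
          16 * (A.xmax ^ 2 * s) := by
        field_simp; ring
      have e7 : 16 * s * (n' * (A.φstar ^ 2 / (32 * s))) = n' * A.φstar ^ 2 / 2 := by
        field_simp; ring
      have e8 : ((τ2:ℝ) - τ1) * A.φstar ^ 2 ≤ n' * A.φstar ^ 2 := by gcongr
      have e9 : (n:ℝ) * A.φstar ^ 2 ≤ 2 * n' * A.φstar ^ 2 := by gcongr
      have e10 : n * A.φstar ^ 2 / 8 ≤ 64 * A.xmax ^ 2 * s * Real.log (1 / δ) +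
        (n' * A.φstar ^ 2 - 16 * s * (n' * (A.φstar ^ 2 / (32 * s))) -
          16 * A.xmax ^ 2 * s * N) := by
        have e12 : 0 < A.xmax ^ 2 * s := by positivity
        rw [e7]; linarith
      have e11 := mul_le_mul_of_nonneg_right e10 (sq_nonneg y)
      linarith)
  refine hd.trans ?_
  rw [hlam n hn1, ← hs]
  have hle := lamF_le A hδ hδ1 hn1 (by linarith)
  have hsq : Real.sqrt (n * LL d δ n) = n * Real.sqrt (LL d δ n / n) := by
    have e : (n:ℝ) * LL d δ n = n ^ 2 * (LL d δ n / n) := by field_simp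
    rw [e, Real.sqrt_mul (by positivity), Real.sqrt_sq hnp.le]
  rw [hsq] at hle
  calc 2 * lamF A δ n * s / (n * A.φstar ^ 2 / 8) ≤
      2 * (12.5 * A.σ * A.xmax * (n * Real.sqrt (LL d δ n / n))) * s / (n * A.φstar ^ 2 / 8) := by
        gcongr
    _ = _ := by field_simp; norm_num; ring

end core


lemma prob_final [MeasurableSpace Ω] (P : Measure Ω) [IsProbabilityMeasure P]
    (E B1 B2 B3 B4 Z : Set Ω) (δ : ℝ) (hδ : 0 < δ)
    (h1 : P B1 ≤ ENNReal.ofReal δ) (h2 : P B2 ≤ ENNReal.ofReal δ) (h3 : P B3 ≤ ENNReal.ofReal δ)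
    (h4 : P B4 ≤ ENNReal.ofReal δ) (hZ : P Z = 0)
    (h : ∀ ω, ω ∉ B1 → ω ∉ B2 → ω ∉ B3 → ω ∉ B4 → ω ∉ Z → ω ∈ E) :
    P E ≥ ENNReal.ofReal (1 - 4 * δ) := by
  have hsub : (Set.univ : Set Ω) ⊆ E ∪ (B1 ∪ (B2 ∪ (B3 ∪ (B4 ∪ Z)))) := by
    intro ω _
    by_contra hc
    simp only [Set.mem_union, not_or] at hc
    exact hc.1 (h ω hc.2.1 hc.2.2.1 hc.2.2.2.1 hc.2.2.2.2.1 hc.2.2.2.2.2)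
  have h5 : (1:ℝ≥0∞) ≤ P E + ENNReal.ofReal (4 * δ) := by
    calc (1:ℝ≥0∞) = P Set.univ := measure_univ.symm
      _ ≤ P (E ∪ (B1 ∪ (B2 ∪ (B3 ∪ (B4 ∪ Z))))) := measure_mono hsub
      _ ≤ P E + (P B1 + (P B2 + (P B3 + (P B4 + P Z)))) := by
        refine (measure_union_le _ _).trans (add_le_add le_rfl ?_)
        refine (measure_union_le _ _).trans (add_le_add le_rfl ?_)
        refine (measure_union_le _ _).trans (add_le_add le_rfl ?_)
        refine (measure_union_le _ _).trans (add_le_add le_rfl ?_)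
        exact measure_union_le _ _
      _ ≤ P E + (ENNReal.ofReal δ + (ENNReal.ofReal δ + (ENNReal.ofReal δ +
          (ENNReal.ofReal δ + 0)))) := by rw [hZ]; gcongr
      _ = P E + ENNReal.ofReal (4 * δ) := by
        rw [add_zero, ← ENNReal.ofReal_add hδ.le hδ.le, ← ENNReal.ofReal_add hδ.le (by positivity),
          ← ENNReal.ofReal_add hδ.le (by positivity)]
        congr 2; ring
  rw [ge_iff_le, ENNReal.ofReal_sub _ (by positivity), ENNReal.ofReal_one]
  exact tsub_le_iff_right.2 h5

set_option maxHeartbeats 2000000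

/-- **Proposition 1 (estimation-error part)**: under the stated choice of `λ_t` and the
compatibility lower bound on `V̂_{M₀+τ₁}`, with probability at least `1 − 4δ`, for every round
`t ≥ M₀ + τ₂ + 1`,
`‖β* − β̂_t‖₁ ≤ (200 σ x_max s₀/φ*²) √((2 log log 2(t−M₀) + log(7d/δ))/(t−M₀))`. -/
theorem proposition1_estimation {Ω : Type*} [MeasurableSpace Ω] (P : Measure Ω)
    {d K : ℕ} (A : FSWLasso Ω P d K)
    (δ : ℝ) (hδ : 0 < δ) (hδ1 : δ ≤ 1)
    (s0 : ℝ) (hs0 : s0 = ((supp A.βstar).card : ℝ))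
    (τ1 τ2 : ℕ) (C2 : ℝ)
    (hC2 : C2 = max 2
      ((400 * A.σ * A.xmax ^ 2 * s0 / (A.Δstar * A.φstar ^ 2)) ^ 2 *
        (80 * A.xmax ^ 2 * s0 / A.φstar ^ 2) ^ (2 / A.α)))
    (hτ2 : (τ2 : ℝ) ≥
      max (max (max
        (C2 * Real.log (7 * d / δ) + 2 * C2 * Real.log (Real.log (28 * d * C2 ^ 2 / δ)))
        ((τ1 : ℝ) + 2048 * A.xmax ^ 4 * s0 ^ 2 / A.φstar ^ 4 *
          (Real.log ((d : ℝ) ^ 2 / δ) + 2 * Real.log (64 * A.xmax ^ 2 * s0 / A.φstar ^ 2))))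
        (2 * (τ1 : ℝ)))
        (A.w ^ 2 * A.M0))
    (hlam : ∀ t : ℕ, A.M0 < t → A.lam t =
      4 * A.σ * A.xmax * (Real.sqrt (2 * A.w ^ 2 * A.M0 * Real.log (2 * d / δ)) +
        (2 : ℝ) ^ ((3 : ℝ) / 4) * Real.sqrt (((t : ℝ) - A.M0) *
          Real.log (7 * d * (Real.log (2 * ((t : ℝ) - A.M0))) ^ 2 / δ))))
    (hV : ∀ᵐ ω ∂P, compat (Vhat A τ1 ω) (supp A.βstar) ≥
      max (4 * A.xmax * s0 / A.Δstar * (80 * A.xmax ^ 2 * s0 / A.φstar ^ 2) ^ (1 / A.α) *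
          A.lam (A.M0 + τ2))
        (64 * A.xmax ^ 2 * s0 * Real.log (1 / δ))) :
    P {ω | ∀ t : ℕ, A.M0 + τ2 + 1 ≤ t →
        l1 (A.βstar - A.βhat t ω) ≤
          200 * A.σ * A.xmax * s0 / A.φstar ^ 2 *
            Real.sqrt ((2 * Real.log (Real.log (2 * ((t : ℝ) - A.M0))) +
              Real.log (7 * d / δ)) / ((t : ℝ) - A.M0))} ≥
      ENNReal.ofReal (1 - 4 * δ) := by
  have := A.probMeas
  have hd := d_pos A
  have hd' : (1:ℝ) ≤ d := by exact_mod_cast hd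
  have hs1 : 1 ≤ s0 := hs0 ▸ card_ge_one A
  have hs0p : 0 < s0 := by linarith
  have hx := A.hxmax
  have hσ := A.hσ
  have hφ := A.hφstar
  have hΔ := A.hΔstar
  have hα := A.hα
  have hq : A.φstar ^ 2 ≤ A.xmax ^ 2 * s0 := hs0 ▸ q_ge A
  set q80 := 80 * A.xmax ^ 2 * s0 / A.φstar ^ 2 with hq80
  have hq80p : 0 < q80 := by positivity
  set G := q80 ^ (1 / A.α) with hGdef
  have hG : 0 < G := Real.rpow_pos_of_pos hq80p _
  have hG2 : q80 ^ (2 / A.α) = G ^ 2 := by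
    rw [hGdef, ← Real.rpow_natCast, ← Real.rpow_mul hq80p.le]
    congr 1; push_cast; ring
  rw [hG2] at hC2
  have hC2a : 2 ≤ C2 := hC2 ▸ le_max_left _ _
  have hC2b : (400 * A.σ * A.xmax ^ 2 * s0 / (A.Δstar * A.φstar ^ 2)) ^ 2 * G ^ 2 ≤ C2 :=
    hC2 ▸ le_max_right _ _
  have ht4 := (le_max_right _ _).trans hτ2
  have ht' := (le_max_left _ _).trans hτ2
  have ht3 := (le_max_right _ _).trans ht'
  have ht'' := (le_max_left _ _).trans ht'
  have ht2 := (le_max_right _ _).trans ht''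
  have ht1 := (le_max_left _ _).trans ht''
  have hτ12 : 2 * τ1 ≤ τ2 := by exact_mod_cast ht3
  have hτ2one : 1 ≤ τ2 := by
    have := (C2_use hd hδ hδ1 hC2a ht1).1
    exact_mod_cast this
  have hR : ∀ n : ℕ, τ2 ≤ n →
      200 * A.σ * A.xmax * s0 / A.φstar ^ 2 * Real.sqrt (LL d δ n / n) ≤
      A.Δstar / (2 * A.xmax * G) := by
    intro n hn
    have hn' : (τ2:ℝ) ≤ n := by exact_mod_cast hn
    obtain ⟨e1, e2⟩ := C2_use hd hδ hδ1 hC2a (ht1.trans hn')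
    exact R_bound hσ hx hs0p hΔ hφ hG (by linarith) (by linarith) hC2b e2
  have hlam' := lam_eq A δ hlam
  -- the effective length `H`
  set Q := A.xmax ^ 2 * s0 / A.φstar ^ 2 with hQ
  have hQ1 : 1 ≤ Q := by rw [hQ, le_div_iff₀ (by positivity)]; linarith
  have hHeq : 2048 * A.xmax ^ 4 * s0 ^ 2 / A.φstar ^ 4 = 2048 * Q ^ 2 := by
    rw [hQ]; field_simp
  have h64 : 64 * A.xmax ^ 2 * s0 / A.φstar ^ 2 = 64 * Q := by rw [hQ]; ring
  rw [hHeq, h64] at ht2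
  have hlogd : 0 ≤ Real.log ((d:ℝ) ^ 2 / δ) := by
    refine Real.log_nonneg ?_
    rw [le_div_iff₀ hδ]; nlinarith
  have hlog64 : 4 ≤ Real.log (64 * Q) := by
    have e1 : Real.log 64 ≤ Real.log (64 * Q) := Real.log_le_log (by norm_num) (by linarith)
    have e2 : Real.log 64 = 6 * Real.log 2 := by
      rw [show (64:ℝ) = 2 ^ 6 by norm_num, Real.log_pow]; norm_num
    have := Real.log_two_gt_d9
    linarith
  have hlong : 16000 * (A.xmax ^ 2 * s0) ≤ ((τ2 : ℝ) - τ1) * A.φstar ^ 2 := by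
    have e1 : A.xmax ^ 2 * s0 = Q * A.φstar ^ 2 := by rw [hQ]; field_simp
    have e2 : 2048 * Q ^ 2 * 8 ≤ 2048 * Q ^ 2 *
        (Real.log ((d:ℝ) ^ 2 / δ) + 2 * Real.log (64 * Q)) := by
      gcongr; linarith
    have e3 : 16000 * Q ≤ (τ2:ℝ) - τ1 := by nlinarith
    rw [e1, ← mul_assoc]
    gcongr
  have hcastτ : ((τ2 - τ1 : ℕ) : ℝ) = (τ2:ℝ) - τ1 := by rw [Nat.cast_sub (by omega)]
  have B1 := event1 A hd δ hδ hδ1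
  have B2 := event2 A hd δ hδ hδ1
  have B3 := event3 A δ (A.M0 + τ1) (τ2 - τ1) (A.φstar ^ 2 / (32 * s0)) (2048 * Q ^ 2)
    (by positivity) (by positivity)
    (by rw [hQ]; field_simp; norm_num)
    (by
      rw [hcastτ]
      have e1 : Real.log ((d:ℝ) ^ 2 / δ) + 2 * Real.log (64 * Q) ≤
          ((τ2:ℝ) - τ1) / (2048 * Q ^ 2) := by
        rw [le_div_iff₀ (by positivity)]; linarith
      have e2 : Real.exp (-(((τ2:ℝ) - τ1) / (2048 * Q ^ 2))) ≤
          Real.exp (-(Real.log ((d:ℝ) ^ 2 / δ) + 2 * Real.log (64 * Q))) :=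
        Real.exp_le_exp.2 (by linarith)
      have e3 : Real.exp (-(Real.log ((d:ℝ) ^ 2 / δ) + 2 * Real.log (64 * Q))) =
          ((d:ℝ) ^ 2 / δ * (64 * Q) ^ 2)⁻¹ := by
        have : 2 * Real.log (64 * Q) = Real.log ((64 * Q) ^ 2) := by
          rw [Real.log_pow]; norm_num
        rw [Real.exp_neg, this, Real.exp_add, Real.exp_log (by positivity),
          Real.exp_log (by positivity)]
      rw [e3] at e2
      calc 2 * (d:ℝ) ^ 2 * (2048 * Q ^ 2 * Real.exp (-(((τ2:ℝ) - τ1) / (2048 * Q ^ 2)))) ≤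
          2 * (d:ℝ) ^ 2 * (2048 * Q ^ 2 * ((d:ℝ) ^ 2 / δ * (64 * Q) ^ 2)⁻¹) := by gcongr
        _ = δ := by field_simp; norm_num
        _ ≤ δ := le_rfl)
  have B4 := event4 A δ hδ (A.M0 + τ1) (A.Δstar / G) (by positivity)
  have hp : (A.Δstar / G / A.Δstar) ^ A.α = A.φstar ^ 2 / (80 * A.xmax ^ 2 * s0) := by
    have e1 : A.Δstar / G / A.Δstar = G⁻¹ := by field_simp
    rw [e1, Real.inv_rpow hG.le, hGdef, ← Real.rpow_mul hq80p.le, one_div_mul_cancel hα.ne',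
      Real.rpow_one, hq80, inv_div]
  rw [hp] at B4
  have hbd : ∀ᵐ ω ∂P, ∀ i, 1 ≤ i → ∀ k j, |A.X i ω k j| ≤ A.xmax := by
    rw [ae_all_iff]; intro i
    by_cases hi : 1 ≤ i
    · filter_upwards [A.bddX i hi] with ω hω _ using hω
    · exact Filter.Eventually.of_forall fun ω h => absurd h hi
  have hop : ∀ᵐ ω ∂P, ∀ i, 1 ≤ i → ∀ a b, optF A.βstar a b (A.X i ω) =
      A.X i ω (A.astar i ω) a * A.X i ω (A.astar i ω) b := by
    rw [ae_all_iff]; intro i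
    by_cases hi : 1 ≤ i
    · filter_upwards [optF_ae A i hi] with ω hω _ using hω
    · exact Filter.Eventually.of_forall fun ω h => absurd h hi
  have hae := ae_iff.1 (hV.and (hbd.and hop))
  refine prob_final P _ _ _ _ _ _ δ hδ B1 B2 B3 B4 hae ?_
  intro ω g1 g2 g3 g4 g5 t ht
  simp only [Set.mem_ofPred_eq, not_not] at g1 g2 g3 g4 g5
  obtain ⟨hv, hb, ho⟩ := g5
  obtain ⟨n, rfl⟩ : ∃ n, t = A.M0 + n := ⟨t - A.M0, by omega⟩
  have hn : τ2 + 1 ≤ n := by omega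
  have hn1 : (1:ℝ) ≤ n := by exact_mod_cast (by omega : 1 ≤ n)
  have e : ((A.M0 + n : ℕ) : ℝ) - A.M0 = n := by push_cast; ring
  rw [hlam' τ2 hτ2one] at hv
  have hfin := det_main A δ hδ hδ1 s0 hs0 τ1 τ2 G hG hlam' hτ2one hR hτ12 ht4 hlong ω hv hb ho
    g1 g2 g3 g4 n hn
  rw [e, ← LL_eq hd hδ hn1]
  exact hfin

end Paper
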